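/- arXiv:2312.06846 — 2 statements merged into one kernel-verified Lean document; each statement's English description precedes it below -/
import Mathlib

section
/- Let (R,m) be a Noetherian local ring and let M be a finitely generated R-module of dimension s ≥ 2. Then e_1(Q,M) = 0 for some parameter ideal Q for M if and only if e_1(Q,M) = 0 for every parameter ideal Q for M. -/
open Finset IsLocalRing

/-- The length of an `R`-module `M`: the Krull dimension of its lattice of submodules,
i.e. the supremum of the lengths of chains of submodules of `M`. -/
noncomputable def moduleLength (R M : Type*) [CommRing R] [AddCommGroup M] [Module R M] :
    WithBot ℕ∞ :=
  Order.krullDim (Submodule R M)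

/-- `e 0, …, e s` are the Hilbert coefficients of a module `M` relative to an ideal `Q`
(`s` the dimension of `M`): for all large `n`,
`λ(M ⧸ Q^(n+1) M) = ∑_{i=0}^{s} (-1)^i (e i) C(n+s-i, s-i)`. -/
def HasHilbertCoeffsMod {R : Type*} (M : Type*) [CommRing R] [AddCommGroup M] [Module R M]
    (Q : Ideal R) (s : ℕ) (e : ℕ → ℤ) : Prop :=
  ∃ N : ℕ, ∀ n ≥ N, ∃ l : ℕ,
    moduleLength R (M ⧸ (Q ^ (n + 1) • ⊤ : Submodule R M)) = (l : WithBot ℕ∞) ∧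
    (l : ℤ) = ∑ i ∈ Finset.range (s + 1), (-1 : ℤ) ^ i * e i * ((n + s - i).choose (s - i))

/-- A parameter ideal for a module `M` of dimension `s`: an ideal generated by `s` elements
of the maximal ideal with `λ(M/QM) < ∞`. -/
def IsParameterIdealFor {R : Type*} [CommRing R] [IsLocalRing R]
    (M : Type*) [AddCommGroup M] [Module R M] (s : ℕ) (Q : Ideal R) : Prop :=
  (∃ x : Fin s → R, (∀ i, x i ∈ maximalIdeal R) ∧ Q = Ideal.span (Set.range x)) ∧
    ∃ l : ℕ, moduleLength R (M ⧸ (Q • ⊤ : Submodule R M)) = (l : WithBot ℕ∞)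

/-- A finitely generated module `M` of dimension `s` is unmixed if `dim(R̂/p) = s = dim M̂`
for every associated prime `p` of the `m`-adic completion `M̂` of `M` over `R̂`. -/
def IsUnmixedModule (R M : Type*) [CommRing R] [IsLocalRing R] [AddCommGroup M] [Module R M]
    (s : ℕ) : Prop :=
  ∀ p ∈ associatedPrimes (AdicCompletion (maximalIdeal R) R)
      (AdicCompletion (maximalIdeal R) M),
    ringKrullDim (AdicCompletion (maximalIdeal R) R ⧸ p) = (s : WithBot ℕ∞)

/-- A module `M` of dimension `s` is Cohen-Macaulay if its depth equals its dimension,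
equivalently, if there is an `M`-regular sequence of length `s` in the maximal ideal. -/
def IsCohenMacaulayModule (R M : Type*) [CommRing R] [IsLocalRing R] [AddCommGroup M]
    [Module R M] (s : ℕ) : Prop :=
  ∃ rs : List R, (∀ x ∈ rs, x ∈ maximalIdeal R) ∧
    RingTheory.Sequence.IsRegular M rs ∧ rs.length = s

section Colength

universe u v w

variable {R : Type u} [CommRing R]

/-- The colength of a submodule as an integer (zero if it is infinite). -/
noncomputable def colength {M : Type v} [AddCommGroup M] [Module R M] (A : Submodule R M) : ℤ :=
  ((Module.length R (M ⧸ A)).toNat : ℤ)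

variable {M : Type v} [AddCommGroup M] [Module R M] {N : Type w} [AddCommGroup N] [Module R N]

theorem colength_eq_of_equiv {A : Submodule R M} {B : Submodule R N} (f : (M ⧸ A) ≃ₗ[R] (N ⧸ B)) :
    colength A = colength B := by
  rw [colength, colength, f.length_eq]

theorem toNat_length_add_of_exact {A : Type*} {B : Type*} {C : Type*} [AddCommGroup A]
    [AddCommGroup B] [AddCommGroup C] [Module R A] [Module R B] [Module R C]
    (f : A →ₗ[R] B) (g : B →ₗ[R] C)
    (hB : IsFiniteLength R B) (hf : Function.Injective f) (hg : Function.Surjective g)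
    (H : Function.Exact f g) :
    (Module.length R B).toNat = (Module.length R A).toNat + (Module.length R C).toNat := by
  have hA := Module.length_ne_top_iff.mpr (hB.of_injective hf)
  have hC := Module.length_ne_top_iff.mpr (hB.of_surjective hg)
  rw [Module.length_eq_add_of_exact f g hf hg H, ENat.toNat_add hA hC]

theorem toNat_length_le_of_surjective {A : Type*} {B : Type*} [AddCommGroup A]
    [AddCommGroup B] [Module R A] [Module R B] (f : A →ₗ[R] B)
    (hA : IsFiniteLength R A) (hf : Function.Surjective f) :
    (Module.length R B).toNat ≤ (Module.length R A).toNat :=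
  ENat.toNat_le_toNat (Module.length_le_of_surjective f hf) (Module.length_ne_top_iff.mpr hA)

theorem colength_eq_add_map {A C : Submodule R M} (hAC : A ≤ C) (hA : IsFiniteLength R (M ⧸ A)) :
    colength A = (Module.length R (C.map A.mkQ)).toNat + colength C := by
  have h := toNat_length_add_of_exact (C.map A.mkQ).subtype (C.map A.mkQ).mkQ hA
    (Submodule.injective_subtype _) (Submodule.mkQ_surjective _)
    (LinearMap.exact_subtype_mkQ _)
  have e := colength_eq_of_equiv (Submodule.quotientQuotientEquivQuotient A C hAC)
  rw [← e]
  simp only [colength]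
  exact_mod_cast h

theorem isFiniteLength_quotient_of_le {A C : Submodule R M} (hAC : A ≤ C)
    (hA : IsFiniteLength R (M ⧸ A)) : IsFiniteLength R (M ⧸ C) :=
  hA.of_surjective (f := Submodule.factor hAC) (Submodule.factor_surjective hAC)

theorem colength_anti {A C : Submodule R M} (hAC : A ≤ C) (hA : IsFiniteLength R (M ⧸ A)) :
    colength C ≤ colength A := by
  have := colength_eq_add_map hAC hA
  omega

/-- Multiplication by `z` maps `C ⧸ A` onto `(B ⊔ z C) ⧸ B` as soon as `z A ≤ B`. -/
theorem colength_sub_le {A B C : Submodule R M} (z : R) (hAC : A ≤ C)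
    (hzA : A ≤ B.comap (LinearMap.lsmul R M z)) (hA : IsFiniteLength R (M ⧸ A))
    (hB : IsFiniteLength R (M ⧸ B)) :
    colength B - colength (B ⊔ C.map (LinearMap.lsmul R M z)) ≤ colength A - colength C := by
  have h1 := colength_eq_add_map hAC hA
  have h2 := colength_eq_add_map (le_sup_left : B ≤ B ⊔ C.map (LinearMap.lsmul R M z)) hB
  set φ := A.mapQ B (LinearMap.lsmul R M z) hzA
  have h3 : (B ⊔ C.map (LinearMap.lsmul R M z)).map B.mkQ = (C.map A.mkQ).map φ := by
    rw [Submodule.map_sup, Submodule.mkQ_map_self, bot_sup_eq, ← Submodule.map_comp,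
      ← Submodule.map_comp, Submodule.mapQ_mkQ]
  rw [h3] at h2
  have h4 := toNat_length_le_of_surjective (φ.submoduleMap (C.map A.mkQ))
    (hA.of_injective (Submodule.injective_subtype _)) (LinearMap.submoduleMap_surjective _ _)
  omega

/-- The exact sequence `0 → M ⧸ (A : y) → M ⧸ A → M ⧸ (A + y M) → 0`. -/
theorem colength_eq_colon_add (A : Submodule R M) (y : R) (hA : IsFiniteLength R (M ⧸ A)) :
    colength A = colength (A.comap (LinearMap.lsmul R M y)) +
      colength (A ⊔ (⊤ : Submodule R M).map (LinearMap.lsmul R M y)) := by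
  set φ : (M ⧸ A.comap (LinearMap.lsmul R M y)) →ₗ[R] (M ⧸ A) :=
    (A.comap (LinearMap.lsmul R M y)).mapQ A (LinearMap.lsmul R M y) le_rfl
  set ψ : (M ⧸ A) →ₗ[R] (M ⧸ A ⊔ (⊤ : Submodule R M).map (LinearMap.lsmul R M y)) :=
    Submodule.factor le_sup_left
  have := toNat_length_add_of_exact φ ψ hA ?_ (Submodule.factor_surjective _) ?_
  · simp only [colength]; exact_mod_cast this
  · rw [← LinearMap.ker_eq_bot, Submodule.ker_mapQ, Submodule.mkQ_map_self]
  · rw [LinearMap.exact_iff]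
    have h1 : LinearMap.ker ψ = (A ⊔ (⊤ : Submodule R M).map (LinearMap.lsmul R M y)).map A.mkQ := by
      change LinearMap.ker (A.mapQ _ LinearMap.id _) = _
      rw [Submodule.ker_mapQ, Submodule.comap_id]
    rw [h1, Submodule.map_sup, Submodule.mkQ_map_self, bot_sup_eq, Submodule.range_mapQ,
      LinearMap.range_eq_map]

theorem colength_map_mkQ (L A : Submodule R M) : colength (A.map L.mkQ) = colength (L ⊔ A) :=
  colength_eq_of_equiv (Submodule.quotientQuotientEquivQuotientSup L A)

theorem smul_top_quotient (L : Submodule R M) (I : Ideal R) :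
    (I • ⊤ : Submodule R (M ⧸ L)) = (I • ⊤ : Submodule R M).map L.mkQ := by
  rw [Submodule.map_smul'', Submodule.map_top, Submodule.range_mkQ]

end Colength

section Open

universe u v w

variable {R : Type u} [CommRing R] [IsLocalRing R]
  {M : Type v} [AddCommGroup M] [Module R M] {N : Type w} [AddCommGroup N] [Module R N]

/-- A submodule is open in the `m`-adic topology. -/
def IsMAdicOpen (A : Submodule R M) : Prop :=
  ∃ k : ℕ, maximalIdeal R ^ k • (⊤ : Submodule R M) ≤ A

theorem IsMAdicOpen.mul {I J : Ideal R} (hI : IsMAdicOpen (I • ⊤ : Submodule R M))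
    (hJ : IsMAdicOpen (J • ⊤ : Submodule R M)) :
    IsMAdicOpen ((I * J) • ⊤ : Submodule R M) := by
  obtain ⟨k, hk⟩ := hI
  obtain ⟨l, hl⟩ := hJ
  refine ⟨k + l, ?_⟩
  rw [pow_add, Submodule.mul_smul, Submodule.mul_smul]
  calc _ ≤ maximalIdeal R ^ k • J • (⊤ : Submodule R M) := Submodule.smul_mono le_rfl hl
    _ = J • maximalIdeal R ^ k • (⊤ : Submodule R M) := by
      rw [← Submodule.mul_smul, mul_comm, Submodule.mul_smul]
    _ ≤ J • I • (⊤ : Submodule R M) := Submodule.smul_mono le_rfl hk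
    _ = _ := by rw [← Submodule.mul_smul, mul_comm, Submodule.mul_smul]

theorem IsMAdicOpen.pow {I : Ideal R} (hI : IsMAdicOpen (I • ⊤ : Submodule R M)) (n : ℕ) :
    IsMAdicOpen (I ^ n • ⊤ : Submodule R M) := by
  induction n with
  | zero => exact ⟨0, by simp⟩
  | succ n ih => rw [pow_succ]; exact ih.mul hI

theorem IsMAdicOpen.quotient {I : Ideal R} (hI : IsMAdicOpen (I • ⊤ : Submodule R M))
    (L : Submodule R M) : IsMAdicOpen (I • ⊤ : Submodule R (M ⧸ L)) := by
  obtain ⟨k, hk⟩ := hI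
  refine ⟨k, ?_⟩
  rw [smul_top_quotient, smul_top_quotient]
  exact Submodule.map_mono hk

theorem isArtinian_of_maximalIdeal_pow_smul_eq_bot [IsNoetherianRing R] (k : ℕ) :
    ∀ (M : Type v) [AddCommGroup M] [Module R M] [Module.Finite R M],
      (maximalIdeal R ^ k • ⊤ : Submodule R M) = ⊥ → IsArtinian R M := by
  induction k with
  | zero =>
    intro M _ _ _ h
    have : Subsingleton M := by
      rw [← Submodule.subsingleton_iff R, ← subsingleton_iff_bot_eq_top, ← h]; simp
    infer_instance
  | succ k ih =>
    intro M _ _ _ h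
    set P : Submodule R M := maximalIdeal R • ⊤
    have h1 : IsArtinian R P := by
      apply ih
      apply Submodule.map_injective_of_injective P.injective_subtype
      rw [Submodule.map_smul'', Submodule.map_top, Submodule.range_subtype, Submodule.map_bot,
        ← Submodule.mul_smul, ← pow_succ, h]
    have h2 : IsArtinian R (M ⧸ P) := by
      let _ : Field (R ⧸ maximalIdeal R) := Ideal.Quotient.field _
      have : Module.Finite (R ⧸ maximalIdeal R) (M ⧸ P) :=
        Module.Finite.of_restrictScalars_finite R _ _
      exact isArtinian_of_surjective_algebraMap (S := R) (R := R ⧸ maximalIdeal R)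
        Ideal.Quotient.mk_surjective
    exact isArtinian_iff_submodule_quotient P |>.mpr ⟨h1, h2⟩

theorem IsMAdicOpen.isFiniteLength [IsNoetherianRing R] [Module.Finite R M] {A : Submodule R M}
    (hA : IsMAdicOpen A) : IsFiniteLength R (M ⧸ A) := by
  obtain ⟨k, hk⟩ := hA
  rw [isFiniteLength_iff_isNoetherian_isArtinian]
  refine ⟨inferInstance, isArtinian_of_maximalIdeal_pow_smul_eq_bot k _ ?_⟩
  rw [smul_top_quotient, eq_bot_iff, Submodule.map_le_iff_le_comap, Submodule.comap_bot,
    Submodule.ker_mkQ]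
  exact hk

theorem exists_maximalIdeal_pow_smul_eq_bot [IsNoetherianRing R] [Module.Finite R M]
    (h : IsFiniteLength R M) : ∃ k : ℕ, (maximalIdeal R ^ k • ⊤ : Submodule R M) = ⊥ := by
  obtain ⟨-, h⟩ := isFiniteLength_iff_isNoetherian_isArtinian.mp h
  obtain ⟨k, hk⟩ := IsArtinian.monotone_stabilizes
    (⟨fun n => OrderDual.toDual (maximalIdeal R ^ n • ⊤ : Submodule R M), fun a b hab =>
      Submodule.smul_mono_left (Ideal.pow_le_pow_right hab)⟩ : ℕ →o (Submodule R M)ᵒᵈ)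
  refine ⟨k, ?_⟩
  have := hk (k + 1) (Nat.le_succ k)
  replace this : (maximalIdeal R ^ k • ⊤ : Submodule R M) = maximalIdeal R ^ (k + 1) • ⊤ := this
  apply Submodule.eq_bot_of_le_smul_of_le_jacobson_bot (maximalIdeal R) _
    (IsNoetherian.noetherian _) _ (IsLocalRing.maximalIdeal_le_jacobson _)
  rw [← Submodule.mul_smul, ← pow_succ', ← this]

theorem isMAdicOpen_iff [IsNoetherianRing R] [Module.Finite R M] {A : Submodule R M} :
    IsMAdicOpen A ↔ IsFiniteLength R (M ⧸ A) := by
  refine ⟨fun h => h.isFiniteLength, fun h => ?_⟩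
  obtain ⟨k, hk⟩ := exists_maximalIdeal_pow_smul_eq_bot h
  refine ⟨k, ?_⟩
  rwa [smul_top_quotient, eq_bot_iff, Submodule.map_le_iff_le_comap, Submodule.comap_bot,
    Submodule.ker_mkQ] at hk

end Open

section HilbertPolynomial

/-- The Hilbert polynomial of degree `s` with coefficients `e`, evaluated at `n`. -/
def hilbPoly (s : ℕ) (e : ℕ → ℤ) (n : ℕ) : ℤ :=
  ∑ i ∈ Finset.range (s + 1), (-1 : ℤ) ^ i * e i * ((n + s - i).choose (s - i))

theorem hilbPoly_zero (e : ℕ → ℤ) (n : ℕ) : hilbPoly 0 e n = e 0 := by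
  simp [hilbPoly]

theorem hilbPoly_one (e : ℕ → ℤ) (n : ℕ) : hilbPoly 1 e n = e 0 * (n + 1) - e 1 := by
  simp [hilbPoly, Finset.sum_range_succ]; ring

theorem hilbPoly_succ_sub (s : ℕ) (e : ℕ → ℤ) (n : ℕ) :
    hilbPoly (s + 1) e (n + 1) - hilbPoly (s + 1) e n = hilbPoly s e (n + 1) := by
  rw [hilbPoly, hilbPoly, hilbPoly, Finset.sum_range_succ, Finset.sum_range_succ _ (s + 1),
    add_sub_add_comm, ← Finset.sum_sub_distrib]
  have : ∀ i ∈ Finset.range (s + 1),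
      (-1 : ℤ) ^ i * e i * ((n + 1 + (s + 1) - i).choose (s + 1 - i)) -
        (-1 : ℤ) ^ i * e i * ((n + (s + 1) - i).choose (s + 1 - i)) =
      (-1 : ℤ) ^ i * e i * ((n + 1 + s - i).choose (s - i)) := by
    intro i hi
    have hi' : i ≤ s := by simpa [Nat.lt_succ_iff] using hi
    have h1 : n + 1 + (s + 1) - i = (n + 1 + s - i) + 1 := by omega
    have h2 : n + (s + 1) - i = n + 1 + s - i := by omega
    have h3 : s + 1 - i = (s - i) + 1 := by omega
    rw [h1, h2, h3, Nat.choose_succ_succ]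
    push_cast
    ring
  rw [Finset.sum_congr rfl this]
  simp

theorem hilbPoly_sub (s : ℕ) (e e' : ℕ → ℤ) (n : ℕ) :
    hilbPoly s (e - e') n = hilbPoly s e n - hilbPoly s e' n := by
  simp only [hilbPoly, ← Finset.sum_sub_distrib, Pi.sub_apply]
  exact Finset.sum_congr rfl fun i _ => by ring

theorem hilbPoly_congr {s : ℕ} {e e' : ℕ → ℤ} (h : ∀ i ≤ s, e i = e' i) (n : ℕ) :
    hilbPoly s e n = hilbPoly s e' n :=
  Finset.sum_congr rfl fun i hi => by rw [h i (by simpa [Nat.lt_succ_iff] using hi)]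

/-- If the first `s` coefficients vanish, the polynomial is constant. -/
theorem hilbPoly_eq_of_forall_lt {s : ℕ} {e : ℕ → ℤ} (h : ∀ i < s, e i = 0) (n : ℕ) :
    hilbPoly s e n = (-1) ^ s * e s := by
  rw [hilbPoly, Finset.sum_range_succ, Finset.sum_eq_zero]
  · simp
  · intro i hi
    rw [h i (by simpa using hi)]; simp

theorem eq_zero_of_hilbPoly_bounded (s : ℕ) : ∀ {e : ℕ → ℤ} {B : ℤ} {N : ℕ},
    (∀ n ≥ N, |hilbPoly s e n| ≤ B) → ∀ i < s, e i = 0 := by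
  induction s with
  | zero => intro e B N _ i hi; omega
  | succ s ih =>
    intro e B N h
    have h1 : ∀ i < s, e i = 0 := by
      apply ih (B := 2 * B) (N := N + 1)
      intro n hn
      obtain ⟨n, rfl⟩ := Nat.exists_eq_add_of_lt (Nat.lt_of_lt_of_le (Nat.succ_pos N) hn)
      rw [zero_add, ← hilbPoly_succ_sub]
      have a1 := abs_le.mp (h (n + 1) (by omega))
      have a2 := abs_le.mp (h n (by omega))
      rw [abs_le]; constructor <;> linarith
    intro i hi
    rcases Nat.lt_succ_iff_lt_or_eq.mp hi with h2 | rfl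
    · exact h1 i h2
    have hstep : ∀ n, hilbPoly (i + 1) e (n + 1) - hilbPoly (i + 1) e n = (-1) ^ i * e i := by
      intro n
      rw [hilbPoly_succ_sub, hilbPoly_eq_of_forall_lt h1]
    have hlin : ∀ k : ℕ, hilbPoly (i + 1) e (N + k) = hilbPoly (i + 1) e N + k * ((-1) ^ i * e i) := by
      intro k
      induction k with
      | zero => simp
      | succ k ihk =>
        have := hstep (N + k)
        rw [← add_assoc]
        push_cast
        linarith
    have hc : (-1) ^ i * e i = 0 := by
      by_contra hne
      have hpos := Int.one_le_abs hne
      have b1 := h N le_rfl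
      have hB : 0 ≤ B := (abs_nonneg _).trans b1
      have b2 := h (N + (2 * B + 1).toNat) (by omega)
      rw [hlin, Int.toNat_of_nonneg (by omega)] at b2
      have b3 : |(2 * B + 1) * ((-1) ^ i * e i)| ≤ 2 * B := by
        have := abs_le.mp b1
        have := abs_le.mp b2
        rw [abs_le]; constructor <;> linarith
      rw [abs_mul, abs_of_nonneg (by omega : 0 ≤ 2 * B + 1)] at b3
      nlinarith
    exact (mul_eq_zero.mp hc).resolve_left (pow_ne_zero _ (by norm_num))

theorem hilbPoly_coeff_unique {s : ℕ} {e e' : ℕ → ℤ} {N : ℕ}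
    (h : ∀ n ≥ N, hilbPoly s e n = hilbPoly s e' n) : ∀ i ≤ s, e i = e' i := by
  have h0 : ∀ n ≥ N, hilbPoly s (e - e') n = 0 := fun n hn => by
    rw [hilbPoly_sub, h n hn, sub_self]
  have h1 := eq_zero_of_hilbPoly_bounded s (e := e - e') (B := 0) (N := N)
    fun n hn => by rw [h0 n hn]; simp
  intro i hi
  rcases hi.lt_or_eq with hi | rfl
  · exact sub_eq_zero.mp (h1 i hi)
  · have := h0 N le_rfl
    rw [hilbPoly_eq_of_forall_lt h1] at this
    exact sub_eq_zero.mp ((mul_eq_zero.mp this).resolve_left (pow_ne_zero _ (by norm_num)))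

/-- A function whose first difference is `hilbPoly s e` is `hilbPoly (s + 1) e'` with
`e'` extending `e`. -/
theorem exists_hilbPoly_of_sub {f : ℕ → ℤ} {s N : ℕ} {e : ℕ → ℤ}
    (h : ∀ n ≥ N, f (n + 1) - f n = hilbPoly s e (n + 1)) :
    ∃ e' : ℕ → ℤ, ∀ n ≥ N, f n = hilbPoly (s + 1) e' n := by
  set c := f N - hilbPoly (s + 1) (Function.update e (s + 1) 0) N
  have key : ∀ d n, hilbPoly (s + 1) (Function.update e (s + 1) d) n =
      hilbPoly (s + 1) (Function.update e (s + 1) 0) n + (-1) ^ (s + 1) * d := by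
    intro d n
    rw [hilbPoly, hilbPoly, Finset.sum_range_succ, Finset.sum_range_succ _ (s + 1)]
    rw [Finset.sum_congr rfl (g := fun i => (-1 : ℤ) ^ i * (Function.update e (s + 1) 0) i *
      ((n + (s + 1) - i).choose (s + 1 - i)))]
    · simp
    · intro i hi
      have : i ≠ s + 1 := by have := Finset.mem_range.mp hi; omega
      simp [Function.update_of_ne this]
  refine ⟨Function.update e (s + 1) ((-1) ^ (s + 1) * c), fun n hn => ?_⟩
  have h2 : hilbPoly (s + 1) (Function.update e (s + 1) ((-1) ^ (s + 1) * c)) N = f N := by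
    rw [key, ← mul_assoc, ← pow_add, ← two_mul, pow_mul]
    simp [c]
  induction n, hn using Nat.le_induction with
  | base => exact h2.symm
  | succ n hn ih =>
    have a1 := h n hn
    have a2 := hilbPoly_succ_sub s (Function.update e (s + 1) ((-1) ^ (s + 1) * c)) n
    rw [hilbPoly_congr (s := s) (e' := e)] at a2
    · linarith
    · intro i hi
      rw [Function.update_of_ne (by omega)]

end HilbertPolynomial

section HasHilbPoly

universe u v w

variable {R : Type u} [CommRing R]

/-- The colengths of the powers of `Q` on `M` are eventually given by `hilbPoly s e`. -/
def HasHilbPoly (M : Type v) [AddCommGroup M] [Module R M] (Q : Ideal R) (s : ℕ) (e : ℕ → ℤ) :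
    Prop :=
  ∃ N : ℕ, ∀ n ≥ N, colength (Q ^ (n + 1) • ⊤ : Submodule R M) = hilbPoly s e n

variable {M : Type v} [AddCommGroup M] [Module R M] {N : Type w} [AddCommGroup N] [Module R N]
  {Q : Ideal R}

theorem HasHilbPoly.unique {s : ℕ} {e e' : ℕ → ℤ} (h : HasHilbPoly M Q s e)
    (h' : HasHilbPoly M Q s e') : ∀ i ≤ s, e i = e' i := by
  obtain ⟨N, h⟩ := h
  obtain ⟨N', h'⟩ := h'
  exact hilbPoly_coeff_unique (N := max N N') fun n hn => by
    rw [← h n (le_of_max_le_left hn), ← h' n (le_of_max_le_right hn)]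

theorem hasHilbertCoeffsMod_iff [IsNoetherianRing R] [IsLocalRing R] [Module.Finite R M]
    (hQ : IsMAdicOpen (Q • ⊤ : Submodule R M)) (s : ℕ) (e : ℕ → ℤ) :
    HasHilbertCoeffsMod M Q s e ↔ HasHilbPoly M Q s e := by
  have hl : ∀ n, ∃ l : ℕ, moduleLength R (M ⧸ (Q ^ n • ⊤ : Submodule R M)) = (l : WithBot ℕ∞) ∧
      (l : ℤ) = colength (Q ^ n • ⊤ : Submodule R M) := by
    intro n
    refine ⟨(Module.length R (M ⧸ (Q ^ n • ⊤ : Submodule R M))).toNat, ?_, rfl⟩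
    rw [moduleLength, ← Module.coe_length]
    have := ENat.natCast_toNat (Module.length_ne_top_iff.mpr (hQ.pow n).isFiniteLength)
    conv_lhs => rw [← this]
    rfl
  constructor
  · rintro ⟨N, h⟩
    refine ⟨N, fun n hn => ?_⟩
    obtain ⟨l, h1, h2⟩ := h n hn
    obtain ⟨l', h3, h4⟩ := hl (n + 1)
    rw [← h4, hilbPoly, ← h2]
    rw [h1] at h3
    exact_mod_cast h3.symm
  · rintro ⟨N, h⟩
    refine ⟨N, fun n hn => ?_⟩
    obtain ⟨l', h3, h4⟩ := hl (n + 1)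
    exact ⟨l', h3, h4.trans (h n hn)⟩

end HasHilbPoly

section NoSocle

universe u v

variable (R : Type u) [CommRing R] [IsLocalRing R] (M : Type v) [AddCommGroup M] [Module R M]

/-- No nonzero element of the module is killed by the maximal ideal. -/
def NoSocle : Prop := ∀ x : M, (∀ a ∈ maximalIdeal R, a • x = 0) → x = 0

variable {R M}

theorem NoSocle.eq_bot_of_pow_smul_eq_bot (h : NoSocle R M) {L : Submodule R M} {k : ℕ}
    (hk : maximalIdeal R ^ k • L = ⊥) : L = ⊥ := by
  induction k with
  | zero => simpa using hk
  | succ k ih =>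
    apply ih
    rw [eq_bot_iff]
    intro x hx
    refine h x fun a ha => ?_
    rw [pow_succ', Submodule.mul_smul] at hk
    simpa [hk] using Submodule.smul_mem_smul ha hx

variable (R M) in
theorem exists_quotient_noSocle [IsNoetherianRing R] [Module.Finite R M] :
    ∃ (L : Submodule R M) (k : ℕ), maximalIdeal R ^ k • L = ⊥ ∧ NoSocle R (M ⧸ L) := by
  obtain ⟨L, ⟨k, hk⟩, hmax⟩ := set_has_maximal_iff_noetherian.mpr
    (inferInstance : IsNoetherian R M) {L | ∃ k : ℕ, maximalIdeal R ^ k • L = ⊥}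
    ⟨⊥, 0, by simp⟩
  refine ⟨L, k, hk, fun x hx => ?_⟩
  obtain ⟨x, rfl⟩ := L.mkQ_surjective x
  have hx' : ∀ a ∈ maximalIdeal R, a • x ∈ L := by
    intro a ha
    have := hx a ha
    rwa [← map_smul, Submodule.mkQ_apply, Submodule.Quotient.mk_eq_zero] at this
  have h1 : maximalIdeal R • (L ⊔ Submodule.span R {x}) ≤ L := by
    rw [Submodule.smul_sup, sup_le_iff]
    refine ⟨Submodule.smul_le_right, ?_⟩
    rw [Submodule.smul_le]
    intro a ha y hy
    obtain ⟨r, rfl⟩ := Submodule.mem_span_singleton.mp hy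
    rw [smul_comm]
    exact L.smul_mem r (hx' a ha)
  have h2 : ∃ k : ℕ, maximalIdeal R ^ k • (L ⊔ Submodule.span R {x}) = ⊥ := by
    refine ⟨k + 1, ?_⟩
    rw [pow_succ, Submodule.mul_smul, eq_bot_iff, ← hk]
    exact Submodule.smul_mono le_rfl h1
  have h3 := hmax _ h2
  have h4 : L ⊔ Submodule.span R {x} = L := by
    by_contra hne
    exact h3 (lt_of_le_of_ne le_sup_left (Ne.symm hne))
  rw [Submodule.mkQ_apply, Submodule.Quotient.mk_eq_zero, ← h4]
  exact Submodule.mem_sup_right (Submodule.mem_span_singleton_self x)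

theorem inf_pow_smul_eq_bot_of_pow_smul_eq_bot [IsNoetherianRing R] [Module.Finite R M]
    {L : Submodule R M} {k : ℕ} (hk : maximalIdeal R ^ k • L = ⊥) {Q : Ideal R}
    (hQ : Q ≤ maximalIdeal R) :
    ∃ n₀, ∀ n ≥ n₀, L ⊓ (Q ^ n • ⊤ : Submodule R M) = ⊥ := by
  obtain ⟨c, hc⟩ := Q.exists_pow_inf_eq_pow_smul L
  refine ⟨c + k, fun n hn => ?_⟩
  rw [inf_comm, hc n (by omega), eq_bot_iff, ← hk]
  exact Submodule.smul_mono ((Ideal.pow_right_mono hQ _).trans (Ideal.pow_le_pow_right (by omega)))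
    inf_le_right

theorem isFiniteLength_of_pow_smul_eq_bot [IsNoetherianRing R] [Module.Finite R M]
    {L : Submodule R M} {k : ℕ} (hk : maximalIdeal R ^ k • L = ⊥) : IsFiniteLength R L := by
  rw [isFiniteLength_iff_isNoetherian_isArtinian]
  refine ⟨inferInstance, isArtinian_of_maximalIdeal_pow_smul_eq_bot k _ ?_⟩
  apply Submodule.map_injective_of_injective L.injective_subtype
  rw [Submodule.map_smul'', Submodule.map_top, Submodule.range_subtype, Submodule.map_bot, hk]

theorem colength_pow_smul_quotient [IsNoetherianRing R] [Module.Finite R M]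
    {L : Submodule R M} {k : ℕ} (hk : maximalIdeal R ^ k • L = ⊥) {Q : Ideal R}
    (hQ : Q ≤ maximalIdeal R) (hQM : IsMAdicOpen (Q • ⊤ : Submodule R M)) :
    ∃ n₀, ∀ n ≥ n₀, colength (Q ^ n • ⊤ : Submodule R M) =
      colength (Q ^ n • ⊤ : Submodule R (M ⧸ L)) + (Module.length R L).toNat := by
  obtain ⟨n₀, h⟩ := inf_pow_smul_eq_bot_of_pow_smul_eq_bot hk hQ
  refine ⟨n₀, fun n hn => ?_⟩
  rw [smul_top_quotient, colength_map_mkQ, add_comm,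
    colength_eq_add_map (C := L ⊔ Q ^ n • ⊤) le_sup_right (hQM.pow n).isFiniteLength]
  congr 3
  rw [Submodule.map_sup, Submodule.mkQ_map_self, sup_bot_eq]
  symm
  refine (LinearEquiv.ofBijective ((Q ^ n • ⊤ : Submodule R M).mkQ.submoduleMap L)
    ⟨?_, LinearMap.submoduleMap_surjective _ _⟩).length_eq
  rw [← LinearMap.ker_eq_bot, eq_bot_iff]
  intro x hx
  have h1 : (Q ^ n • ⊤ : Submodule R M).mkQ x = 0 := congrArg Subtype.val (LinearMap.mem_ker.mp hx)
  rw [Submodule.mkQ_apply, Submodule.Quotient.mk_eq_zero] at h1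
  have h2 : (x : M) ∈ L ⊓ (Q ^ n • ⊤ : Submodule R M) := ⟨x.2, h1⟩
  rw [h n hn] at h2
  simpa using h2

end NoSocle

section Shift

universe u v w

theorem hilbPoly_add_const (s : ℕ) (e : ℕ → ℤ) (c : ℤ) (n : ℕ) :
    hilbPoly s e n + c = hilbPoly s (Function.update e s (e s + (-1) ^ s * c)) n := by
  rw [hilbPoly, hilbPoly, Finset.sum_range_succ, Finset.sum_range_succ _ s,
    Finset.sum_congr rfl (g := fun i => (-1 : ℤ) ^ i *
      (Function.update e s (e s + (-1) ^ s * c)) i * ((n + s - i).choose (s - i)))]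
  · have : ((-1 : ℤ) ^ s) * (-1) ^ s = 1 := by rw [← pow_add, ← two_mul, pow_mul]; simp
    simp only [Function.update_self, Nat.sub_self, Nat.choose_zero_right, Nat.cast_one, mul_one]
    linear_combination (-c) * this
  · intro i hi
    have : i ≠ s := by have := Finset.mem_range.mp hi; omega
    simp [Function.update_of_ne this]

variable {R : Type u} [CommRing R] {M : Type v} [AddCommGroup M] [Module R M]
  {N : Type w} [AddCommGroup N] [Module R N]

theorem HasHilbPoly.add_const {Q : Ideal R} {s : ℕ} {e : ℕ → ℤ} (h : HasHilbPoly M Q s e) {c : ℤ}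
    (hc : ∃ n₀, ∀ n ≥ n₀,
      colength (Q ^ n • ⊤ : Submodule R N) = colength (Q ^ n • ⊤ : Submodule R M) + c) :
    HasHilbPoly N Q s (Function.update e s (e s + (-1) ^ s * c)) := by
  obtain ⟨n₀, hc⟩ := hc
  obtain ⟨n₁, h⟩ := h
  refine ⟨max n₀ n₁, fun n hn => ?_⟩
  rw [hc (n + 1) (by omega), h n (by omega), hilbPoly_add_const]

variable [IsLocalRing R] [IsNoetherianRing R] [Module.Finite R M]
    {L : Submodule R M} {k : ℕ} {Q : Ideal R}

theorem HasHilbPoly.quotient_finiteLength {s : ℕ} {e : ℕ → ℤ} (h : HasHilbPoly M Q s e)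
    (hk : maximalIdeal R ^ k • L = ⊥)
    (hQ : Q ≤ maximalIdeal R) (hQM : IsMAdicOpen (Q • ⊤ : Submodule R M)) :
    ∃ e', HasHilbPoly (M ⧸ L) Q s e' ∧ ∀ i < s, e' i = e i := by
  refine ⟨_, h.add_const (c := -((Module.length R L).toNat : ℤ)) ?_, fun i hi => ?_⟩
  · obtain ⟨n₀, h⟩ := colength_pow_smul_quotient hk hQ hQM
    exact ⟨n₀, fun n hn => by rw [h n hn]; ring⟩
  · rw [Function.update_of_ne hi.ne]

theorem HasHilbPoly.of_quotient_finiteLength {s : ℕ} {e : ℕ → ℤ}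
    (h : HasHilbPoly (M ⧸ L) Q s e) (hk : maximalIdeal R ^ k • L = ⊥)
    (hQ : Q ≤ maximalIdeal R) (hQM : IsMAdicOpen (Q • ⊤ : Submodule R M)) :
    HasHilbPoly M Q s (Function.update e s (e s + (-1) ^ s * (Module.length R L).toNat)) :=
  h.add_const (colength_pow_smul_quotient hk hQ hQM)

end Shift

section Superficial

universe u v

variable {R : Type u} [CommRing R] {M : Type v} [AddCommGroup M] [Module R M]

theorem map_lsmul_top (y : R) :
    (⊤ : Submodule R M).map (LinearMap.lsmul R M y) = Ideal.span {y} • ⊤ := by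
  rw [Submodule.ideal_span_singleton_smul]; rfl

/-- The colon submodule `Q ^ (n + 1) M : y`. -/
def powColon (M : Type v) [AddCommGroup M] [Module R M] (Q : Ideal R) (y : R) (n : ℕ) :
    Submodule R M :=
  (Q ^ (n + 1) • ⊤ : Submodule R M).comap (LinearMap.lsmul R M y)

theorem mem_powColon {Q : Ideal R} {y : R} {n : ℕ} {x : M} :
    x ∈ powColon M Q y n ↔ y • x ∈ (Q ^ (n + 1) • ⊤ : Submodule R M) := Iff.rfl

theorem pow_smul_le_powColon {Q : Ideal R} {y : R} (hy : y ∈ Q) (n : ℕ) :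
    (Q ^ n • ⊤ : Submodule R M) ≤ powColon M Q y n := by
  intro x hx
  rw [mem_powColon, pow_succ', Submodule.mul_smul]
  exact Submodule.smul_mem_smul hy hx

theorem smul_top_eq_of_sup {Q J : Ideal R} {y : R} (h : Q = Ideal.span {y} ⊔ J) :
    (Q • ⊤ : Submodule R (M ⧸ (Ideal.span {y} • ⊤ : Submodule R M))) = J • ⊤ := by
  rw [h, Submodule.sup_smul, smul_top_quotient, Submodule.mkQ_map_self, bot_sup_eq]

theorem pow_smul_top_eq_of_sup {Q J : Ideal R} {y : R} (h : Q = Ideal.span {y} ⊔ J) (n : ℕ) :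
    (Q ^ n • ⊤ : Submodule R (M ⧸ (Ideal.span {y} • ⊤ : Submodule R M))) = J ^ n • ⊤ := by
  induction n with
  | zero => simp
  | succ n ih =>
    rw [pow_succ, mul_comm, Submodule.mul_smul, ih, ← Submodule.mul_smul, mul_comm,
      Submodule.mul_smul, smul_top_eq_of_sup h, ← Submodule.mul_smul, pow_succ]

theorem HasHilbPoly.of_sup {Q J : Ideal R} {y : R} (h : Q = Ideal.span {y} ⊔ J) {s : ℕ}
    {e : ℕ → ℤ} :
    HasHilbPoly (M ⧸ (Ideal.span {y} • ⊤ : Submodule R M)) Q s e ↔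
      HasHilbPoly (M ⧸ (Ideal.span {y} • ⊤ : Submodule R M)) J s e := by
  simp only [HasHilbPoly, pow_smul_top_eq_of_sup h]

variable [IsLocalRing R] [IsNoetherianRing R] [Module.Finite R M] {Q : Ideal R} {y : R}

theorem colength_pow_succ_smul (hQM : IsMAdicOpen (Q • ⊤ : Submodule R M)) (n : ℕ) :
    colength (Q ^ (n + 1) • ⊤ : Submodule R M) = colength (powColon M Q y n) +
      colength (Q ^ (n + 1) • ⊤ : Submodule R (M ⧸ (Ideal.span {y} • ⊤ : Submodule R M))) := by
  rw [colength_eq_colon_add _ y (hQM.pow _).isFiniteLength, smul_top_quotient, colength_map_mkQ,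
    map_lsmul_top, sup_comm]
  rfl

theorem HasHilbPoly.quotient_of_powColon_eq (hQM : IsMAdicOpen (Q • ⊤ : Submodule R M))
    (hC : ∃ D, ∀ n ≥ D, powColon M Q y n = Q ^ n • ⊤) {s : ℕ} {e : ℕ → ℤ} :
    HasHilbPoly M Q (s + 1) e →
      HasHilbPoly (M ⧸ (Ideal.span {y} • ⊤ : Submodule R M)) Q s e := by
  rintro ⟨n₀, h⟩
  obtain ⟨D, hC⟩ := hC
  refine ⟨n₀ + D + 1, fun n hn => ?_⟩
  obtain ⟨n, rfl⟩ := Nat.exists_eq_add_of_lt (Nat.lt_of_lt_of_le (Nat.succ_pos _) hn)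
  rw [zero_add]
  have h1 := colength_pow_succ_smul (y := y) hQM (n + 1)
  rw [hC _ (by omega), h n (by omega), h (n + 1) (by omega)] at h1
  rw [← hilbPoly_succ_sub]
  linarith

theorem HasHilbPoly.exists_of_quotient (hQM : IsMAdicOpen (Q • ⊤ : Submodule R M))
    (hC : ∃ D, ∀ n ≥ D, powColon M Q y n = Q ^ n • ⊤) {s : ℕ} {e : ℕ → ℤ}
    (h : HasHilbPoly (M ⧸ (Ideal.span {y} • ⊤ : Submodule R M)) Q s e) :
    ∃ e', HasHilbPoly M Q (s + 1) e' := by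
  obtain ⟨n₀, h⟩ := h
  obtain ⟨D, hC⟩ := hC
  have key : ∀ n ≥ n₀ + D, (fun n => colength (Q ^ (n + 1) • ⊤ : Submodule R M)) (n + 1) -
      (fun n => colength (Q ^ (n + 1) • ⊤ : Submodule R M)) n = hilbPoly s e (n + 1) := by
    intro n hn
    have h1 := colength_pow_succ_smul (y := y) hQM (n + 1)
    rw [hC _ (by omega), h (n + 1) (by omega)] at h1
    simp only
    linarith
  obtain ⟨e', he'⟩ := exists_hilbPoly_of_sub
    (f := fun n => colength (Q ^ (n + 1) • ⊤ : Submodule R M)) key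
  exact ⟨e', _, he'⟩

/-- Passing to the quotient by an element whose colon submodules are eventually controlled by
`z` preserves all Hilbert coefficients but the last one. -/
theorem HasHilbPoly.eq_of_quotient_of_powColon_le (hQM : IsMAdicOpen (Q • ⊤ : Submodule R M))
    (hy : y ∈ Q) {z : R} (hz : z ∈ Q)
    (hC : ∃ D, ∀ n ≥ D, powColon M Q y (n + 1) ≤
      Q ^ (n + 1) • ⊤ ⊔ (powColon M Q y n).map (LinearMap.lsmul R M z)) {s : ℕ} {e e' : ℕ → ℤ}
    (h : HasHilbPoly M Q (s + 1) e)
    (h' : HasHilbPoly (M ⧸ (Ideal.span {y} • ⊤ : Submodule R M)) Q s e') :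
    ∀ i < s, e i = e' i := by
  obtain ⟨D, hC⟩ := hC
  obtain ⟨n₀, h⟩ := h
  obtain ⟨n₁, h'⟩ := h'
  have hfl := fun n => (hQM.pow n).isFiniteLength
  set d : ℕ → ℤ := fun n => colength (Q ^ n • ⊤ : Submodule R M) - colength (powColon M Q y n)
    with hd
  have hd0 : ∀ n, 0 ≤ d n := fun n =>
    sub_nonneg.mpr (colength_anti (pow_smul_le_powColon hy n) (hfl n))
  have hdle : ∀ n ≥ D, d (n + 1) ≤ d n := by
    intro n hn
    have h1 := colength_sub_le (B := (Q ^ (n + 1) • ⊤ : Submodule R M)) z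
      (pow_smul_le_powColon hy n) (pow_smul_le_powColon (M := M) hz n) (hfl n) (hfl _)
    have h2 := colength_anti (hC n hn)
      (isFiniteLength_quotient_of_le (pow_smul_le_powColon hy _) (hfl (n + 1)))
    simp only [hd]
    linarith
  have hdB : ∀ n ≥ D, d n ≤ d D := by
    intro n hn
    induction n, hn using Nat.le_induction with
    | base => exact le_rfl
    | succ n hn ih => exact (hdle n hn).trans ih
  have h3 := eq_zero_of_hilbPoly_bounded s (e := e' - e) (B := d D) (N := D + n₀ + n₁ + 1) ?_
  · intro i hi
    exact (sub_eq_zero.mp (h3 i hi)).symm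
  · intro n hn
    obtain ⟨n, rfl⟩ := Nat.exists_eq_add_of_lt (Nat.lt_of_lt_of_le (Nat.succ_pos _) hn)
    rw [zero_add, hilbPoly_sub, ← h' _ (by omega), ← hilbPoly_succ_sub, ← h n (by omega),
      ← h (n + 1) (by omega)]
    have h1 := colength_pow_succ_smul (y := y) hQM (n + 1)
    have h4 := hd0 (n + 1)
    have h5 := hdB (n + 1) (by omega)
    simp only [hd] at h4 h5 ⊢
    rw [abs_le]
    constructor <;> linarith

end Superficial

section Avoidance

universe u v

variable {R : Type u} [CommRing R]

/-- Over a local ring with infinite residue field, every nontrivial module is infinite. -/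
theorem infinite_of_nontrivial_of_infinite_residueField [IsLocalRing R] [Infinite (ResidueField R)]
    (X : Type v) [AddCommGroup X] [Module R X] [Nontrivial X] : Infinite X := by
  obtain ⟨x, hx⟩ := exists_ne (0 : X)
  refine Infinite.of_injective
    (fun c : ResidueField R => Function.surjInv (residue_surjective (R := R)) c • x) ?_
  intro c d hcd
  by_contra hne
  set a := Function.surjInv (residue_surjective (R := R)) c
  set b := Function.surjInv (residue_surjective (R := R)) d
  have hab : (a - b) • x = 0 := by rw [sub_smul, sub_eq_zero]; exact hcd
  have hu : IsUnit (a - b) := by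
    by_contra hnu
    apply hne
    have h := (residue_eq_zero_iff (a - b)).mpr ((mem_maximalIdeal _).mpr hnu)
    rw [map_sub, Function.surjInv_eq residue_surjective, Function.surjInv_eq residue_surjective,
      sub_eq_zero] at h
    exact h
  exact hx (hu.smul_eq_zero.mp hab)

theorem exists_mem_forall_notMem [IsLocalRing R] [Infinite (ResidueField R)] (I : Ideal R)
    {B : Set (Ideal R)} (hB : B.Finite) (h : ∀ W ∈ B, ¬ I ≤ W) : ∃ y ∈ I, ∀ W ∈ B, y ∉ W := by
  by_contra! hcon
  have hcov : ⋃ W ∈ hB.toFinset, (Submodule.comap I.subtype W : Set I) = Set.univ := by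
    rw [Set.eq_univ_iff_forall]
    rintro ⟨y, hy⟩
    obtain ⟨W, hW, hyW⟩ := hcon y hy
    simp only [Set.mem_iUnion]
    exact ⟨W, by simpa using hW, hyW⟩
  obtain ⟨W, hW, hfi⟩ := Submodule.exists_finiteIndex_of_cover hcov
  have : Finite (I ⧸ Submodule.comap I.subtype W) :=
    AddSubgroup.finite_quotient_of_finiteIndex
  have : Nontrivial (I ⧸ Submodule.comap I.subtype W) := by
    rw [Submodule.Quotient.nontrivial_iff]
    intro htop
    apply h W (by simpa using hW)
    intro y hy
    have : (⟨y, hy⟩ : I) ∈ Submodule.comap I.subtype W := htop ▸ Submodule.mem_top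
    exact this
  have := infinite_of_nontrivial_of_infinite_residueField (R := R)
    (I ⧸ Submodule.comap I.subtype W)
  exact not_finite (I ⧸ Submodule.comap I.subtype W)

/-- An element avoiding finitely many primes not containing `I` is a nonzerodivisor up to
`I`-power torsion. -/
theorem exists_primes_smul_eq_zero_imp [IsNoetherianRing R] (G : Type v) [AddCommGroup G]
    [Module R G] [Module.Finite R G] (I : Ideal R) :
    ∃ (N : ℕ) (P : Set (Ideal R)), P.Finite ∧ (∀ p ∈ P, ¬ I ≤ p) ∧
      ∀ y : R, (∀ p ∈ P, y ∉ p) → ∀ x : G, y • x = 0 → ∀ a ∈ I ^ N, a • x = 0 := by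
  have hmono : Monotone fun n => Submodule.torsionBySet R G ((I ^ n : Ideal R) : Set R) :=
    fun a b hab => Submodule.torsionBySet_le_torsionBySet_of_subset (Ideal.pow_le_pow_right hab)
  obtain ⟨N, hN⟩ := monotone_stabilizes_iff_noetherian.mpr (inferInstance : IsNoetherian R G)
    ⟨_, hmono⟩
  set L := Submodule.torsionBySet R G ((I ^ N : Ideal R) : Set R) with hL
  have hN1 : Submodule.torsionBySet R G ((I ^ (N + 1) : Ideal R) : Set R) = L :=
    (hN (N + 1) N.le_succ).symm
  have memL : ∀ x, x ∈ L ↔ ∀ a ∈ I ^ N, a • x = 0 := fun x => by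
    rw [hL, Submodule.mem_torsionBySet_iff]; simp
  refine ⟨N, associatedPrimes R (G ⧸ L), associatedPrimes.finite R _, ?_, ?_⟩
  · intro p hp hIp
    obtain ⟨hprime, g, hg⟩ := isAssociatedPrime_iff.mp hp
    obtain ⟨g, rfl⟩ := L.mkQ_surjective g
    have hgL : g ∉ L := by
      intro hgL
      have h0 : L.mkQ g = 0 := by rwa [Submodule.mkQ_apply, Submodule.Quotient.mk_eq_zero]
      rw [h0] at hg
      exact hprime.ne_top (by rw [hg, Ideal.eq_top_iff_one]; simp)
    have hIg : ∀ a ∈ I, a • g ∈ L := by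
      intro a ha
      have h1 := hIp ha
      rw [hg] at h1
      simp only [Submodule.mem_colon_singleton, Submodule.mem_bot] at h1
      rwa [← map_smul, Submodule.mkQ_apply, Submodule.Quotient.mk_eq_zero] at h1
    apply hgL
    rw [← hN1, Submodule.mem_torsionBySet_iff]
    rintro ⟨a, ha⟩
    change a • g = 0
    change a ∈ I ^ (N + 1) at ha
    rw [pow_succ] at ha
    refine Submodule.mul_induction_on ha (fun b hb c hc => ?_) (fun b c hb hc => ?_)
    · rw [mul_smul]
      exact (memL _).mp (hIg c hc) b hb
    · rw [add_smul, hb, hc, add_zero]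
  · intro y hy x hyx
    rw [← memL]
    by_contra hx
    have hz : y ∈ ⋃ p ∈ associatedPrimes R (G ⧸ L), (p : Set R) := by
      rw [biUnion_associatedPrimes_eq_zero_divisors]
      refine ⟨L.mkQ x, ?_, ?_⟩
      · rwa [Submodule.mkQ_apply, Ne, Submodule.Quotient.mk_eq_zero]
      · rw [← map_smul, hyx, map_zero]
    simp only [Set.mem_iUnion] at hz
    obtain ⟨p, hp, hyp⟩ := hz
    exact hy p hp hyp

end Avoidance

section Rees

universe u v

variable {R : Type u} [CommRing R] [IsNoetherianRing R]
variable (M : Type v) [AddCommGroup M] [Module R M] [Module.Finite R M]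

/-- The filtration `n ↦ Q ^ (n + 1) M`. -/
def Ideal.shiftedFiltration (Q : Ideal R) : Q.Filtration M where
  N n := Q ^ (n + 1) • ⊤
  mono n := Submodule.smul_mono_left (Ideal.pow_le_pow_right (by omega))
  smul_le n := by rw [← Submodule.mul_smul, ← pow_succ']

/-- Elements of `I ≤ Q` whose initial forms are nonzerodivisors on the associated graded module
up to torsion with respect to the ideal generated by the initial forms of `I`. -/
theorem exists_ideals_smul_mem_pow_imp {I Q : Ideal R} (hIQ : I ≤ Q) :
    ∃ (N : ℕ) (B : Set (Ideal R)), B.Finite ∧ (∀ W ∈ B, ¬ I ≤ W) ∧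
      ∀ y ∈ I, (∀ W ∈ B, y ∉ W) → ∀ (n : ℕ) (x : M), x ∈ (Q ^ n • ⊤ : Submodule R M) →
        y • x ∈ (Q ^ (n + 2) • ⊤ : Submodule R M) →
          ∀ a ∈ I ^ N, a • x ∈ (Q ^ (n + N + 1) • ⊤ : Submodule R M) := by
  set A := reesAlgebra Q
  set X : Submodule A (PolynomialModule R M) := (Q.stableFiltration ⊤).submodule
  set Y : Submodule A (PolynomialModule R M) := (Q.shiftedFiltration M).submodule
  have hX : X.FG := (Ideal.Filtration.submodule_fg_iff_stable _
    fun i => IsNoetherian.noetherian _).mpr (Q.stableFiltration_stable ⊤)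
  have hGfin : Module.Finite A (X.map Y.mkQ) := Module.Finite.iff_fg.mpr (hX.map _)
  have hmon : ∀ (n : ℕ) (b : R), b ∈ Q ^ n → Polynomial.monomial n b ∈ A :=
    fun n b hb => reesAlgebra.monomial_mem.mpr hb
  let t : Q →ₗ[R] A :=
    { toFun := fun b => ⟨Polynomial.monomial 1 b.1, hmon 1 b.1 (by simp)⟩
      map_add' := fun a b => Subtype.ext (by simp)
      map_smul' := fun r b => Subtype.ext (by simp [Polynomial.smul_monomial]) }
  set T : Ideal A := Ideal.span (t '' (Submodule.comap Q.subtype I : Set Q))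
  obtain ⟨N, P, hPfin, hTP, hP⟩ := exists_primes_smul_eq_zero_imp (X.map Y.mkQ) T
  have hpow : ∀ (n : ℕ) (b : R), b ∈ I ^ n → ∃ h, (⟨Polynomial.monomial n b, h⟩ : A) ∈ T ^ n := by
    intro n
    induction n with
    | zero => intro b hb; exact ⟨hmon 0 b (by simp), by simp⟩
    | succ n ih =>
      intro b hb
      rw [pow_succ] at hb
      refine Submodule.mul_induction_on hb (fun c hc d hd => ?_) (fun c d hc hd => ?_)
      · obtain ⟨h, h1⟩ := ih c hc
        have h2 : t ⟨d, hIQ hd⟩ ∈ T := Ideal.subset_span ⟨⟨d, hIQ hd⟩, hd, rfl⟩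
        have h3 := Ideal.mul_mem_mul h1 h2
        rw [← pow_succ] at h3
        have h4 : (⟨Polynomial.monomial n c, h⟩ : A) * t ⟨d, hIQ hd⟩ =
          ⟨Polynomial.monomial (n + 1) (c * d), hmon _ _ (by
            rw [pow_succ]; exact Ideal.mul_mem_mul (Ideal.pow_right_mono hIQ n hc) (hIQ hd))⟩ :=
          Subtype.ext (by simp [t, Polynomial.monomial_mul_monomial])
        rw [h4] at h3
        exact ⟨_, h3⟩
      · obtain ⟨h1, h2⟩ := hc
        obtain ⟨h3, h4⟩ := hd
        have h5 := (T ^ (n + 1)).add_mem h2 h4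
        refine ⟨by rw [map_add]; exact A.add_mem h1 h3, ?_⟩
        convert h5 using 1
        exact Subtype.ext (by simp)
  refine ⟨N, (fun p => ((p.restrictScalars R).comap t).map Q.subtype) '' P, hPfin.image _, ?_, ?_⟩
  · rintro _ ⟨p, hp, rfl⟩ hle
    apply hTP p hp
    rw [Ideal.span_le]
    rintro _ ⟨⟨b, hbQ⟩, hb, rfl⟩
    obtain ⟨⟨c, hc⟩, h1, h2⟩ := hle hb
    have : c = b := h2
    subst this
    exact h1
  · intro y hyI hy n x hx hyx a ha
    have hxX : PolynomialModule.single R n x ∈ X := by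
      intro i
      rw [PolynomialModule.coeff_single, Finsupp.single_apply]
      split_ifs with h
      · subst h; exact hx
      · exact Submodule.zero_mem _
    have hY : ∀ (j : ℕ) (z : M), PolynomialModule.single R j z ∈ Y ↔
        z ∈ (Q ^ (j + 1) • ⊤ : Submodule R M) := by
      intro j z
      constructor
      · intro h
        have := h j
        rwa [PolynomialModule.coeff_single, Finsupp.single_eq_same] at this
      · intro h i
        rw [PolynomialModule.coeff_single, Finsupp.single_apply]
        split_ifs with h'
        · subst h'; exact h
        · exact Submodule.zero_mem _
    have hsmul : ∀ (f : A) (g : X.map Y.mkQ) (u : PolynomialModule R M), g.1 = Y.mkQ u →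
        (f • g = 0 ↔ f • u ∈ Y) := by
      intro f g u hu
      rw [← Submodule.coe_eq_zero, Submodule.coe_smul, hu, ← map_smul, Submodule.mkQ_apply,
        Submodule.Quotient.mk_eq_zero]
    obtain ⟨h, hT⟩ := hpow N a ha
    have hmain := hP (t ⟨y, hIQ hyI⟩) ?_ ⟨Y.mkQ (PolynomialModule.single R n x),
      Submodule.mem_map_of_mem hxX⟩ ?_ _ hT
    · rw [hsmul _ _ _ rfl] at hmain
      rw [Subalgebra.smul_def, PolynomialModule.monomial_smul_single, hY] at hmain
      rwa [add_comm N n] at hmain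
    · intro p hp hyp
      exact hy _ ⟨p, hp, rfl⟩ ⟨⟨y, hIQ hyI⟩, hyp, rfl⟩
    · rw [hsmul _ _ _ rfl]
      rw [Subalgebra.smul_def]
      change Polynomial.monomial 1 y • _ ∈ _
      rw [PolynomialModule.monomial_smul_single, hY, add_comm 1 n]
      exact hyx

end Rees

section Colon

universe u v

variable {R : Type u} [CommRing R] {M : Type v} [AddCommGroup M] [Module R M]

theorem Ideal.sup_pow_succ_le (I : Ideal R) (z : R) (k : ℕ) :
    (I ⊔ Ideal.span {z}) ^ (k + 1) ≤
      I ^ (k + 1) ⊔ Ideal.span {z} * (I ⊔ Ideal.span {z}) ^ k := by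
  induction k with
  | zero => simp
  | succ k ih =>
    rw [pow_succ', Ideal.sup_mul, sup_le_iff]
    refine ⟨?_, le_sup_right⟩
    calc I * (I ⊔ Ideal.span {z}) ^ (k + 1)
        ≤ I * (I ^ (k + 1) ⊔ Ideal.span {z} * (I ⊔ Ideal.span {z}) ^ k) :=
          Ideal.mul_mono_right ih
      _ = I ^ (k + 1 + 1) ⊔ Ideal.span {z} * (I * (I ⊔ Ideal.span {z}) ^ k) := by
          rw [Ideal.mul_sup, ← pow_succ', mul_left_comm]
      _ ≤ _ := sup_le_sup_left (Ideal.mul_mono_right (by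
          rw [pow_succ']; exact Ideal.mul_mono_left le_sup_left)) _

variable {Q : Ideal R} {y : R}

theorem smul_powColon_le (n : ℕ) :
    Q • powColon M Q y n ≤ powColon M Q y (n + 1) := by
  rw [Submodule.smul_le]
  intro a ha x hx
  rw [mem_powColon, smul_comm, pow_succ', Submodule.mul_smul]
  exact Submodule.smul_mem_smul ha hx

theorem powColon_succ_le (n : ℕ) : powColon M Q y (n + 1) ≤ powColon M Q y n := fun _ hx =>
  Submodule.smul_mono_left (Ideal.pow_le_pow_right (by omega)) hx

theorem powColon_eq_of_le_zero (hy : y ∈ Q)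
    (h : ∃ D, ∀ n ≥ D, powColon M Q y (n + 1) ≤
        Q ^ (n + 1) • ⊤ ⊔ (powColon M Q y n).map (LinearMap.lsmul R M 0)) :
    ∃ D, ∀ n ≥ D, powColon M Q y n = Q ^ n • ⊤ := by
  obtain ⟨D, h⟩ := h
  refine ⟨D + 1, fun n hn => ?_⟩
  obtain ⟨n, rfl⟩ := Nat.exists_eq_add_of_le' (show 1 ≤ n by omega)
  refine le_antisymm ?_ (pow_smul_le_powColon hy _)
  simpa using h n (by omega)

variable [IsNoetherianRing R] [Module.Finite R M]

theorem exists_powColon_le (hreg : IsSMulRegular M y) :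
    ∃ c, ∀ n, powColon M Q y n ≤ Q ^ (n - c) • ⊤ := by
  obtain ⟨c, hc⟩ := Q.exists_pow_inf_eq_pow_smul (Ideal.span {y} • ⊤ : Submodule R M)
  refine ⟨c, fun n x hx => ?_⟩
  rcases lt_or_ge n c with h | h
  · rw [Nat.sub_eq_zero_of_le h.le]; simp
  have h1 : y • x ∈ (Q ^ (n + 1) • ⊤ ⊓ Ideal.span {y} • ⊤ : Submodule R M) :=
    ⟨hx, Submodule.smul_mem_smul (Ideal.mem_span_singleton_self y) Submodule.mem_top⟩
  rw [hc (n + 1) (by omega)] at h1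
  have h2 : y • x ∈ Ideal.span {y} • (Q ^ (n - c) • ⊤ : Submodule R M) := by
    rw [← Submodule.mul_smul, mul_comm, Submodule.mul_smul]
    exact Submodule.smul_mono (Ideal.pow_le_pow_right (by omega)) inf_le_right h1
  rw [Submodule.ideal_span_singleton_smul] at h2
  obtain ⟨w, hw, hwx⟩ := h2
  rwa [← hreg hwx]

theorem exists_pow_smul_powColon_eq (hreg : IsSMulRegular M y) :
    ∃ D, ∀ n ≥ D, ∀ k, powColon M Q y (n + k) = Q ^ k • powColon M Q y n := by
  obtain ⟨c, hc⟩ := exists_powColon_le (Q := Q) hreg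
  let F : Q.Filtration M :=
    { N := fun n => powColon M Q y (n + c)
      mono := fun n => by rw [add_right_comm]; exact powColon_succ_le _
      smul_le := fun n => by rw [add_right_comm]; exact smul_powColon_le _ }
  have hF : F.Stable := (Q.stableFiltration_stable ⊤).of_le (F' := F) fun n => by
    have := hc (n + c)
    rwa [Nat.add_sub_cancel] at this
  obtain ⟨D, hD⟩ := hF
  have h1 : ∀ n ≥ D + c, powColon M Q y (n + 1) = Q • powColon M Q y n := by
    intro n hn
    obtain ⟨n, rfl⟩ := Nat.exists_eq_add_of_le' (show c ≤ n by omega)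
    rw [add_right_comm]
    exact (hD n (by omega)).symm
  refine ⟨D + c, fun n hn k => ?_⟩
  induction k with
  | zero => simp
  | succ k ih => rw [← add_assoc, h1 _ (by omega), ih, ← Submodule.mul_smul, pow_succ']

theorem exists_powColon_succ_le {I : Ideal R} {z : R} (hQ : Q = I ⊔ Ideal.span {z}) (hy : y ∈ I)
    (hreg : IsSMulRegular M y) {N : ℕ}
    (hN : ∀ (n : ℕ) (x : M), x ∈ (Q ^ n • ⊤ : Submodule R M) →
        y • x ∈ (Q ^ (n + 2) • ⊤ : Submodule R M) →
          ∀ a ∈ I ^ N, a • x ∈ (Q ^ (n + N + 1) • ⊤ : Submodule R M)) :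
    ∃ D, ∀ n ≥ D, powColon M Q y (n + 1) ≤
      Q ^ (n + 1) • ⊤ ⊔ (powColon M Q y n).map (LinearMap.lsmul R M z) := by
  have hIQ : I ≤ Q := hQ ▸ le_sup_left
  have hyQ : y ∈ Q := hIQ hy
  obtain ⟨c, hc⟩ := exists_powColon_le (Q := Q) hreg
  obtain ⟨D, hD⟩ := exists_pow_smul_powColon_eq (Q := Q) hreg
  have h1 : ∀ n ≥ c, ∀ j ≤ c,
      I ^ (N * j) • powColon M Q y n ≤ Q ^ (n - c + (N * j) + j) • ⊤ := by
    intro n hn j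
    induction j with
    | zero => intro _; simpa using hc n
    | succ j ih =>
      intro hj
      rw [show N * (j + 1) = N + N * j by ring, pow_add, Submodule.mul_smul, Submodule.smul_le]
      intro a ha x hx
      have h2 := ih (by omega) hx
      have h3 : y • x ∈ (Q ^ (n + 1 + N * j) • ⊤ : Submodule R M) := by
        have : I ^ (N * j) • powColon M Q y n ≤
            (Q ^ (n + 1 + N * j) • ⊤ : Submodule R M).comap (LinearMap.lsmul R M y) := by
          rw [Submodule.smul_le]
          intro b hb w hw
          change y • b • w ∈ (Q ^ (n + 1 + N * j) • ⊤ : Submodule R M)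
          rw [smul_comm, add_comm, pow_add, Submodule.mul_smul]
          exact Submodule.smul_mem_smul (Ideal.pow_right_mono hIQ _ hb) hw
        exact this hx
      have h4 := hN _ x h2 (Submodule.smul_mono_left (Ideal.pow_le_pow_right (by omega)) h3) a ha
      convert h4 using 3
      omega
  have h2 : ∀ n ≥ c, I ^ (N * c) • powColon M Q y n ≤ Q ^ (n + N * c) • ⊤ := by
    intro n hn
    have := h1 n hn c le_rfl
    rwa [show n - c + N * c + c = n + N * c by omega] at this
  refine ⟨D + c + N * c, fun n hn => ?_⟩
  obtain ⟨n, rfl⟩ := Nat.exists_eq_add_of_le' (show N * c ≤ n by omega)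
  have h3 := Ideal.sup_pow_succ_le I z (N * c)
  rw [← hQ] at h3
  rw [add_assoc, hD n (by omega)]
  refine (Submodule.smul_mono_left h3).trans ?_
  rw [Submodule.sup_smul]
  refine sup_le_sup ?_ ?_
  · rw [pow_succ', Submodule.mul_smul, ← add_assoc, pow_succ', Submodule.mul_smul]
    exact Submodule.smul_mono hIQ (h2 n (by omega))
  · rw [Submodule.mul_smul, ← hD n (by omega), Submodule.ideal_span_singleton_smul]
    exact le_rfl

end Colon

section SuperficialElements

universe u v

variable {R : Type u} [CommRing R]

/-- The ideal can be generated by `k` elements. -/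
def GeneratedBy (k : ℕ) (I : Ideal R) : Prop := ∃ x : Fin k → R, I = Ideal.span (Set.range x)

theorem GeneratedBy.exists_sup [IsLocalRing R] {k : ℕ} {I : Ideal R} (hI : GeneratedBy (k + 1) I)
    {y : R} (hyI : y ∈ I) (hy : y ∉ maximalIdeal R * I) :
    ∃ J, GeneratedBy k J ∧ I = Ideal.span {y} ⊔ J := by
  obtain ⟨x, rfl⟩ := hI
  obtain ⟨c, hc⟩ := (Submodule.mem_span_range_iff_exists_fun R).mp hyI
  obtain ⟨i, hi⟩ : ∃ i, IsUnit (c i) := by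
    by_contra! h
    apply hy
    rw [← hc]
    exact Submodule.sum_mem _ fun i _ => Ideal.mul_mem_mul ((mem_maximalIdeal _).mpr (h i))
      (Ideal.subset_span ⟨i, rfl⟩)
  refine ⟨_, ⟨fun j => x (i.succAbove j), rfl⟩, le_antisymm ?_ ?_⟩
  · have hj : ∀ j, x (i.succAbove j) ∈
        Ideal.span {y} ⊔ Ideal.span (Set.range fun j => x (i.succAbove j)) := fun j =>
      Ideal.mem_sup_right (Ideal.subset_span ⟨j, rfl⟩)
    rw [Ideal.span_le]
    rintro _ ⟨j, rfl⟩
    rcases Fin.eq_self_or_eq_succAbove i j with rfl | ⟨j, rfl⟩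
    · rw [SetLike.mem_coe, ← Ideal.unit_mul_mem_iff_mem _ hi]
      rw [Fin.sum_univ_succAbove _ j] at hc
      have : c j * x j = y - ∑ l, c (j.succAbove l) • x (j.succAbove l) := by
        rw [← hc]; simp
      rw [this]
      exact Ideal.sub_mem _ (Ideal.mem_sup_left (Ideal.mem_span_singleton_self y))
        (Ideal.sum_mem _ fun l _ => Ideal.mul_mem_left _ _ (hj l))
    · exact hj j
  · rw [sup_le_iff, Ideal.span_le, Ideal.span_le]
    constructor
    · simpa using hyI
    · rintro _ ⟨j, rfl⟩
      exact Ideal.subset_span ⟨_, rfl⟩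

variable [IsNoetherianRing R] [IsLocalRing R] (M : Type v) [AddCommGroup M] [Module R M]
  [Module.Finite R M]

/-- Outside finitely many ideals not containing `I`, every element `y` of `I` is regular on `M`,
is superficial for `Q = I + (z)` up to `z`, and is a minimal generator of `I`. -/
theorem exists_finite_superficial {I Q : Ideal R} {z : R} {k : ℕ} (hQ : Q = I ⊔ Ideal.span {z})
    (hI : GeneratedBy (k + 1) I)
    (hAss : ∀ p ∈ associatedPrimes R M, ¬ I ≤ p) :
    ∃ B : Set (Ideal R), B.Finite ∧ (∀ W ∈ B, ¬ I ≤ W) ∧ ∀ y ∈ I, (∀ W ∈ B, y ∉ W) →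
      IsSMulRegular M y ∧
      (∃ D, ∀ n ≥ D, powColon M Q y (n + 1) ≤
        Q ^ (n + 1) • ⊤ ⊔ (powColon M Q y n).map (LinearMap.lsmul R M z)) ∧
      ∃ J, GeneratedBy k J ∧ I = Ideal.span {y} ⊔ J := by
  have hIQ : I ≤ Q := hQ ▸ le_sup_left
  obtain ⟨N, B, hB, hIB, h⟩ := exists_ideals_smul_mem_pow_imp M hIQ
  have hreg : ∀ y : R, (∀ p ∈ associatedPrimes R M, y ∉ p) → IsSMulRegular M y := by
    intro y hy
    by_contra hr
    have : y ∈ ⋃ p ∈ associatedPrimes R M, (p : Set R) := by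
      rw [biUnion_associatedPrimes_eq_compl_regular]; exact hr
    simp only [Set.mem_iUnion] at this
    obtain ⟨p, hp, hyp⟩ := this
    exact hy p hp hyp
  rcases eq_or_ne I ⊥ with h0 | h0
  · refine ⟨B ∪ associatedPrimes R M, hB.union (associatedPrimes.finite R M), ?_, ?_⟩
    · rintro W (hW | hW)
      exacts [hIB W hW, hAss W hW]
    · intro y hy hyB
      have hyr := hreg y fun p hp => hyB p (Or.inr hp)
      refine ⟨hyr, exists_powColon_succ_le hQ hy hyr
        (h y hy fun W hW => hyB W (Or.inl hW)), ⊥, ⟨fun _ => 0, ?_⟩, ?_⟩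
      · symm; rw [Ideal.span_eq_bot]; rintro _ ⟨_, rfl⟩; rfl
      · have : y = 0 := by simpa [h0] using hy
        simp [h0, this]
  · refine ⟨B ∪ associatedPrimes R M ∪ {maximalIdeal R * I},
      (hB.union (associatedPrimes.finite R M)).union (Set.finite_singleton _), ?_, ?_⟩
    · rintro W ((hW | hW) | hW)
      · exact hIB W hW
      · exact hAss W hW
      · rw [Set.mem_singleton_iff.mp hW]
        intro hle
        exact h0 (Submodule.eq_bot_of_le_smul_of_le_jacobson_bot (maximalIdeal R) I
          (IsNoetherian.noetherian _) hle (IsLocalRing.maximalIdeal_le_jacobson _))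
    · intro y hy hyB
      have hyr := hreg y fun p hp => hyB p (Or.inl (Or.inr hp))
      exact ⟨hyr, exists_powColon_succ_le hQ hy hyr
        (h y hy fun W hW => hyB W (Or.inl (Or.inl hW))), hI.exists_sup hy (hyB _ (Or.inr rfl))⟩

end SuperficialElements

section OpenIdeals

universe u v

variable {R : Type u} [CommRing R] [IsLocalRing R] {M : Type v} [AddCommGroup M] [Module R M]

theorem eq_maximalIdeal_of_isMAdicOpen [Module.Finite R M] {I p : Ideal R}
    (hI : IsMAdicOpen (I • ⊤ : Submodule R M))
    (hp : p.IsPrime) (hpM : Module.annihilator R M ≤ p) (hIp : I ≤ p) : p = maximalIdeal R := by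
  obtain ⟨k, hk⟩ := hI
  let P : PrimeSpectrum R := ⟨p, hp⟩
  have h1 : P ∈ Module.support R (M ⧸ (p • ⊤ : Submodule R M)) := by
    rw [Module.support_quotient]
    exact ⟨Module.mem_support_iff_of_finite.mpr hpM,
      (PrimeSpectrum.mem_zeroLocus _ _).mpr le_rfl⟩
  have h2 : maximalIdeal R ^ k ≤ p := by
    refine le_trans ?_ (Module.mem_support_iff_of_finite.mp h1)
    intro a ha
    rw [Module.mem_annihilator]
    intro x
    obtain ⟨x, rfl⟩ := Submodule.mkQ_surjective _ x
    rw [← map_smul, Submodule.mkQ_apply, Submodule.Quotient.mk_eq_zero]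
    exact Submodule.smul_mono_left hIp (hk (Submodule.smul_mem_smul ha Submodule.mem_top))
  exact ((maximalIdeal.isMaximal R).eq_of_le hp.ne_top (hp.le_of_pow_le h2)).symm

theorem NoSocle.not_le_of_isMAdicOpen [IsNoetherianRing R] [Module.Finite R M]
    (hM : NoSocle R M) {I : Ideal R}
    (hI : IsMAdicOpen (I • ⊤ : Submodule R M)) : ∀ p ∈ associatedPrimes R M, ¬ I ≤ p := by
  intro p hp hIp
  have h := eq_maximalIdeal_of_isMAdicOpen hI hp.isPrime
    (Submodule.annihilator_top.symm.le.trans hp.annihilator_le) hIp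
  obtain ⟨hpp, x, hx⟩ := isAssociatedPrime_iff.mp hp
  have hx0 : x = 0 := hM x fun a ha => by
    rw [← h, hx] at ha
    simpa [Submodule.mem_colon_singleton] using ha
  apply hpp.ne_top
  rw [hx, hx0, Ideal.eq_top_iff_one]
  simp [Submodule.mem_colon_singleton]

end OpenIdeals

section Existence

universe u v

variable {R : Type u} [CommRing R] [IsNoetherianRing R] [IsLocalRing R]

/-- Outside finitely many ideals not containing `Q`, every element of `Q` is regular on `M`,
superficial for `Q`, and a minimal generator of `Q`. -/
theorem NoSocle.exists_finite_superficial {M : Type v} [AddCommGroup M] [Module R M]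
    [Module.Finite R M] (hM : NoSocle R M) {Q : Ideal R} {k : ℕ} (hQ : GeneratedBy (k + 1) Q)
    (hQM : IsMAdicOpen (Q • ⊤ : Submodule R M)) :
    ∃ B : Set (Ideal R), B.Finite ∧ (∀ W ∈ B, ¬ Q ≤ W) ∧ ∀ y ∈ Q, (∀ W ∈ B, y ∉ W) →
      IsSMulRegular M y ∧ (∃ D, ∀ n ≥ D, powColon M Q y n = Q ^ n • ⊤) ∧
      ∃ J, GeneratedBy k J ∧ Q = Ideal.span {y} ⊔ J := by
  obtain ⟨B, hB, hQB, h⟩ := _root_.exists_finite_superficial M (I := Q) (Q := Q) (z := 0)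
    (by simp) hQ (hM.not_le_of_isMAdicOpen hQM)
  refine ⟨B, hB, hQB, fun y hy hyB => ?_⟩
  obtain ⟨h1, h2, h3⟩ := h y hy hyB
  exact ⟨h1, powColon_eq_of_le_zero hy h2, h3⟩

theorem exists_hasHilbPoly [Infinite (ResidueField R)] {s : ℕ} {Q : Ideal R}
    (hQ : GeneratedBy s Q) (hQm : Q ≤ maximalIdeal R) {M : Type v} [AddCommGroup M] [Module R M]
    [Module.Finite R M] (hQM : IsMAdicOpen (Q • ⊤ : Submodule R M)) :
    ∃ e, HasHilbPoly M Q s e := by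
  induction s generalizing Q M with
  | zero =>
    obtain ⟨x, rfl⟩ := hQ
    refine ⟨fun _ => colength (⊥ : Submodule R M), 0, fun n _ => ?_⟩
    rw [hilbPoly_zero, Set.range_eq_empty, Ideal.span_empty, Ideal.bot_pow (by omega),
      Submodule.bot_smul]
  | succ s ih =>
    obtain ⟨L, k, hk, hN⟩ := exists_quotient_noSocle R M
    have hQN := hQM.quotient L
    obtain ⟨B, hB, hQB, h⟩ := hN.exists_finite_superficial hQ hQN
    obtain ⟨y, hy, hyB⟩ := exists_mem_forall_notMem Q hB hQB
    obtain ⟨-, hC, J, hJ, hQJ⟩ := h y hy hyB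
    obtain ⟨e, he⟩ := ih hJ ((le_sup_right.trans hQJ.ge).trans hQm)
      (M := (M ⧸ L) ⧸ (Ideal.span {y} • ⊤ : Submodule R (M ⧸ L))) (by
        rw [← smul_top_eq_of_sup hQJ]; exact hQN.quotient _)
    obtain ⟨e', he'⟩ := HasHilbPoly.exists_of_quotient hQN hC ((HasHilbPoly.of_sup hQJ).mpr he)
    exact ⟨_, he'.of_quotient_finiteLength hk hQm hQM⟩

end Existence

section LowDimension

universe u v

variable {R : Type u} [CommRing R]

theorem IsSMulRegular.powColon_span_singleton {M : Type v} [AddCommGroup M] [Module R M] {z : R}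
    (hz : IsSMulRegular M z) (n : ℕ) :
    powColon M (Ideal.span {z}) z n = Ideal.span {z} ^ n • ⊤ := by
  refine le_antisymm (fun x hx => ?_) (pow_smul_le_powColon (Ideal.mem_span_singleton_self z) n)
  rw [mem_powColon, Ideal.span_singleton_pow, Submodule.ideal_span_singleton_smul] at hx
  obtain ⟨w, hw, hwx⟩ := hx
  rw [Ideal.span_singleton_pow, Submodule.ideal_span_singleton_smul]
  refine ⟨w, hw, hz ?_⟩
  simpa [pow_succ', mul_smul] using hwx

theorem NoSocle.exchange [IsLocalRing R] {M : Type v} [AddCommGroup M] [Module R M] {y y' : R}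
    (hy : IsSMulRegular M y) (hy' : IsSMulRegular M y') (hym : y ∈ maximalIdeal R)
    (h : NoSocle R (M ⧸ (Ideal.span {y} • ⊤ : Submodule R M))) :
    NoSocle R (M ⧸ (Ideal.span {y'} • ⊤ : Submodule R M)) := by
  have key : ∀ (z : R) (x : M), x ∈ (Ideal.span {z} • ⊤ : Submodule R M) ↔ ∃ w, z • w = x := by
    intro z x
    rw [Submodule.ideal_span_singleton_smul]
    exact ⟨fun ⟨w, _, h⟩ => ⟨w, h⟩, fun ⟨w, h⟩ => ⟨w, trivial, h⟩⟩
  intro x hx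
  obtain ⟨x, rfl⟩ := Submodule.mkQ_surjective _ x
  simp only [Submodule.mkQ_apply, ← Submodule.Quotient.mk_smul, Submodule.Quotient.mk_eq_zero,
    key] at hx ⊢
  obtain ⟨w, hw⟩ := hx y hym
  have h1 : w ∈ (Ideal.span {y} • ⊤ : Submodule R M) := by
    rw [← Submodule.Quotient.mk_eq_zero, ← Submodule.mkQ_apply]
    refine h _ fun a ha => ?_
    rw [← map_smul, Submodule.mkQ_apply, Submodule.Quotient.mk_eq_zero, key]
    obtain ⟨v, hv⟩ := hx a ha
    refine ⟨v, hy' ?_⟩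
    change y' • y • v = y' • a • w
    rw [smul_comm, hv, smul_comm y' a, hw, smul_comm]
  obtain ⟨v, rfl⟩ := (key _ _).mp h1
  refine ⟨v, hy ?_⟩
  change y • y' • v = y • x
  rw [← hw, smul_comm]

variable [IsNoetherianRing R] [IsLocalRing R]

theorem hasHilbPoly_span_singleton {M : Type v} [AddCommGroup M] [Module R M] [Module.Finite R M]
    {z : R} (hz : IsSMulRegular M z)
    (hM : IsMAdicOpen (Ideal.span {z} • ⊤ : Submodule R M)) :
    ∃ e, HasHilbPoly M (Ideal.span {z}) 1 e ∧ e 1 = 0 := by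
  set c := colength (⊥ : Submodule R (M ⧸ (Ideal.span {z} • ⊤ : Submodule R M))) with hc
  have h : ∀ n : ℕ, colength (Ideal.span {z} ^ n • ⊤ : Submodule R M) = n * c := by
    intro n
    induction n with
    | zero =>
      have : Subsingleton (M ⧸ (⊤ : Submodule R M)) :=
        Submodule.Quotient.subsingleton_iff.mpr rfl
      simp [colength, Module.length_eq_zero]
    | succ n ih =>
      rw [colength_pow_succ_smul (y := z) hM, hz.powColon_span_singleton, ih,
        pow_smul_top_eq_of_sup (J := ⊥) (by simp), Ideal.bot_pow (by omega), Submodule.bot_smul]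
      push_cast
      ring
  refine ⟨fun i => if i = 0 then c else 0, ⟨0, fun n _ => ?_⟩, by simp⟩
  rw [h, hilbPoly_one]
  push_cast
  simp [mul_comm]

theorem GeneratedBy.coeff_one_eq_zero_iff {Q : Ideal R} (hQ : GeneratedBy 1 Q)
    (hQm : Q ≤ maximalIdeal R) {M : Type v} [AddCommGroup M] [Module R M] [Module.Finite R M]
    (hQM : IsMAdicOpen (Q • ⊤ : Submodule R M)) {e : ℕ → ℤ} (he : HasHilbPoly M Q 1 e) :
    e 1 = 0 ↔ NoSocle R M := by
  obtain ⟨x, rfl⟩ := hQ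
  rw [Set.range_unique] at *
  set z := x default
  obtain ⟨L, k, hk, hN⟩ := exists_quotient_noSocle R M
  have hQN := hQM.quotient L
  have hz : IsSMulRegular (M ⧸ L) z := by
    by_contra hr
    have : z ∈ ⋃ p ∈ associatedPrimes R (M ⧸ L), (p : Set R) := by
      rw [biUnion_associatedPrimes_eq_compl_regular]; exact hr
    simp only [Set.mem_iUnion] at this
    obtain ⟨p, hp, hyp⟩ := this
    exact hN.not_le_of_isMAdicOpen hQN p hp ((Ideal.span_singleton_le_iff_mem p).mpr hyp)
  obtain ⟨e', he', he0⟩ := hasHilbPoly_span_singleton hz hQN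
  have h1 := he.unique (he'.of_quotient_finiteLength hk hQm hQM) 1 le_rfl
  rw [h1, Function.update_self, he0]
  have h2 : (Module.length R L).toNat = 0 ↔ L = ⊥ := by
    rw [ENat.toNat_eq_zero, Module.length_eq_zero_iff, Submodule.subsingleton_iff_eq_bot,
      or_iff_left (Module.length_ne_top_iff.mpr (isFiniteLength_of_pow_smul_eq_bot hk))]
  have h3 : NoSocle R M ↔ L = ⊥ := by
    refine ⟨fun h => h.eq_bot_of_pow_smul_eq_bot hk, ?_⟩
    rintro rfl x hx
    have := hN (Submodule.Quotient.mk x) fun a ha => by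
      rw [← Submodule.Quotient.mk_smul, hx a ha, Submodule.Quotient.mk_zero]
    rwa [Submodule.Quotient.mk_eq_zero, Submodule.mem_bot] at this
  rw [h3, ← h2]
  omega

theorem coeff_one_eq_zero_of_generatedBy_two [Infinite (ResidueField R)] {Q Q' : Ideal R}
    (hQ : GeneratedBy 2 Q) (hQ' : GeneratedBy 2 Q') (hQm : Q ≤ maximalIdeal R)
    (hQm' : Q' ≤ maximalIdeal R) {M : Type v} [AddCommGroup M] [Module R M] [Module.Finite R M]
    (hQM : IsMAdicOpen (Q • ⊤ : Submodule R M)) (hQM' : IsMAdicOpen (Q' • ⊤ : Submodule R M))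
    {e e' : ℕ → ℤ} (he : HasHilbPoly M Q 2 e) (he' : HasHilbPoly M Q' 2 e') (h0 : e 1 = 0) :
    e' 1 = 0 := by
  obtain ⟨L, k, hk, hN⟩ := exists_quotient_noSocle R M
  have key : ∀ (Q : Ideal R) (e : ℕ → ℤ), GeneratedBy 2 Q → Q ≤ maximalIdeal R →
      IsMAdicOpen (Q • ⊤ : Submodule R M) → HasHilbPoly M Q 2 e →
      ∃ y ∈ maximalIdeal R, IsSMulRegular (M ⧸ L) y ∧
        (e 1 = 0 ↔ NoSocle R ((M ⧸ L) ⧸ (Ideal.span {y} • ⊤ : Submodule R (M ⧸ L)))) := by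
    intro Q e hQ hQm hQM he
    have hQN := hQM.quotient L
    obtain ⟨B, hB, hQB, h⟩ := hN.exists_finite_superficial hQ hQN
    obtain ⟨y, hy, hyB⟩ := exists_mem_forall_notMem Q hB hQB
    obtain ⟨hreg, hC, J, hJ, hQJ⟩ := h y hy hyB
    obtain ⟨e', he', hee'⟩ := he.quotient_finiteLength hk hQm hQM
    refine ⟨y, hQm hy, hreg, ?_⟩
    rw [← hee' 1 (by omega)]
    refine hJ.coeff_one_eq_zero_iff ((le_sup_right.trans hQJ.ge).trans hQm) ?_
      ((HasHilbPoly.of_sup hQJ).mp (he'.quotient_of_powColon_eq hQN hC))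
    rw [← smul_top_eq_of_sup hQJ]
    exact hQN.quotient _
  obtain ⟨y, hy, hreg, h⟩ := key Q e hQ hQm hQM he
  obtain ⟨y', -, hreg', h'⟩ := key Q' e' hQ' hQm' hQM' he'
  exact h'.mpr (NoSocle.exchange hreg hreg' hy (h.mp h0))

end LowDimension

section Dimension

universe u v

variable {R : Type u} [CommRing R]

theorem GeneratedBy.span_sup {k : ℕ} {J : Ideal R} (hJ : GeneratedBy k J) (x : R) :
    GeneratedBy (k + 1) (Ideal.span {x} ⊔ J) := by
  obtain ⟨y, rfl⟩ := hJ
  exact ⟨Fin.cons x y, by rw [Fin.range_cons, Ideal.span_insert]⟩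

theorem GeneratedBy.exists_span_sup {k : ℕ} {Q : Ideal R} (hQ : GeneratedBy (k + 1) Q) :
    ∃ x J, GeneratedBy k J ∧ Q = Ideal.span {x} ⊔ J := by
  obtain ⟨y, rfl⟩ := hQ
  refine ⟨y 0, _, ⟨Fin.tail y, rfl⟩, ?_⟩
  rw [← Ideal.span_insert, ← Fin.range_cons, Fin.cons_self_tail]

variable {M : Type v} [AddCommGroup M] [Module R M]

theorem supportDim_quotient_span_singleton_smul (x : R) :
    Module.supportDim R (M ⧸ (Ideal.span {x} • ⊤ : Submodule R M)) =
      Module.supportDim R (QuotSMulTop x M) :=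
  Module.supportDim_eq_of_equiv
    (Submodule.quotEquivOfEq _ _ (Submodule.ideal_span_singleton_smul x ⊤))

variable [IsLocalRing R]

theorem IsMAdicOpen.of_quotient {x : R} {J : Ideal R}
    (h : IsMAdicOpen (J • ⊤ : Submodule R (M ⧸ (Ideal.span {x} • ⊤ : Submodule R M)))) :
    IsMAdicOpen ((Ideal.span {x} ⊔ J) • ⊤ : Submodule R M) := by
  obtain ⟨k, hk⟩ := h
  refine ⟨k, ?_⟩
  rw [smul_top_quotient, smul_top_quotient, Submodule.map_le_iff_le_comap,
    Submodule.comap_map_mkQ, ← Submodule.sup_smul] at hk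
  exact hk

theorem supportDim_nonpos [Module.Finite R M]
    (h : ∀ p : Ideal R, p.IsPrime → Module.annihilator R M ≤ p → p = maximalIdeal R) :
    Module.supportDim R M ≤ 0 := by
  have : Subsingleton (Module.support R M) := ⟨fun p q => Subtype.ext (PrimeSpectrum.ext (by
    rw [h _ p.1.2 (Module.mem_support_iff_of_finite.mp p.2),
      h _ q.1.2 (Module.mem_support_iff_of_finite.mp q.2)]))⟩
  exact Order.krullDim_nonpos_of_subsingleton

variable [Module.Finite R M]

theorem supportDim_quotient_le {k : ℕ} (hM : Module.supportDim R M ≤ (k + 1 : ℕ)) {x : R}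
    (hx : ∀ p ∈ (Module.annihilator R M).minimalPrimes, p ≠ maximalIdeal R → x ∉ p) :
    Module.supportDim R (M ⧸ (Ideal.span {x} • ⊤ : Submodule R M)) ≤ k := by
  by_cases hm : maximalIdeal R ∈ (Module.annihilator R M).minimalPrimes
  · refine (Module.supportDim_le_of_surjective _ (Submodule.mkQ_surjective _)).trans
      ((supportDim_nonpos fun p hp hpM => ?_).trans (by positivity))
    exact le_antisymm (le_maximalIdeal hp.ne_top)
      (hm.2 ⟨hp, hpM⟩ (le_maximalIdeal hp.ne_top))
  · rw [supportDim_quotient_span_singleton_smul]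
    have h := (Module.supportDim_quotSMulTop_succ_le_of_notMem_minimalPrimes (M := M) (x := x)
      fun p hp => hx p hp fun h => hm (h ▸ hp)).trans hM
    push_cast at h
    exact ENat.WithBot.add_le_add_one_right_iff.mp h

variable [IsNoetherianRing R]

theorem GeneratedBy.supportDim_le {k : ℕ} {Q : Ideal R} (hQ : GeneratedBy k Q)
    (hQm : Q ≤ maximalIdeal R) (hQM : IsMAdicOpen (Q • ⊤ : Submodule R M)) :
    Module.supportDim R M ≤ k := by
  induction k generalizing Q M with
  | zero =>
    obtain ⟨x, rfl⟩ := hQ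
    rw [Set.range_eq_empty, Ideal.span_empty] at hQM
    exact supportDim_nonpos fun p hp hpM =>
      eq_maximalIdeal_of_isMAdicOpen hQM hp hpM bot_le
  | succ k ih =>
    obtain ⟨x, J, hJ, h⟩ := hQ.exists_span_sup
    have hx : x ∈ maximalIdeal R := hQm (h ▸ Ideal.mem_sup_left (Ideal.mem_span_singleton_self x))
    have h1 := ih (M := M ⧸ (Ideal.span {x} • ⊤ : Submodule R M)) hJ
      ((le_sup_right.trans h.ge).trans hQm) (by
        rw [← smul_top_eq_of_sup h]; exact hQM.quotient _)
    refine (Module.supportDim_le_supportDim_quotSMulTop_succ hx).trans ?_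
    rw [← supportDim_quotient_span_singleton_smul]
    push_cast
    gcongr

theorem isMAdicOpen_bot_of_supportDim_nonpos (h : Module.supportDim R M ≤ 0) :
    IsMAdicOpen (⊥ : Submodule R M) := by
  rcases subsingleton_or_nontrivial M with hM | hM
  · exact ⟨0, fun x _ => by simp [Subsingleton.elim x 0]⟩
  have h0 : Module.supportDim R M = 0 :=
    have : Nonempty (Module.support R M) := Module.nonempty_support_of_nontrivial.to_subtype
    le_antisymm h Order.krullDim_nonneg
  have h1 := support_of_supportDim_eq_zero R M h0
  have h2 : maximalIdeal R ≤ (Module.annihilator R M).radical := by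
    rw [Ideal.radical_eq_sInf]
    refine le_sInf fun p ⟨hpM, hp⟩ => ?_
    have : (⟨p, hp⟩ : PrimeSpectrum R) ∈ Module.support R M :=
      Module.mem_support_iff_of_finite.mpr hpM
    rwa [h1] at this
  obtain ⟨k, hk⟩ := Ideal.exists_pow_le_of_le_radical_of_fg h2 (IsNoetherian.noetherian _)
  refine ⟨k, ?_⟩
  rw [Submodule.smul_le]
  intro a ha x _
  exact Module.mem_annihilator.mp (hk ha) x

theorem exists_generatedBy_isMAdicOpen {k : ℕ} (hM : Module.supportDim R M ≤ k) {I : Ideal R}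
    (hI : IsMAdicOpen (I • ⊤ : Submodule R M)) :
    ∃ J ≤ I, GeneratedBy k J ∧ IsMAdicOpen (J • ⊤ : Submodule R M) := by
  induction k generalizing M with
  | zero =>
    refine ⟨⊥, bot_le, ⟨Fin.elim0, ?_⟩, ?_⟩
    · rw [Set.range_eq_empty, Ideal.span_empty]
    · rw [Submodule.bot_smul]
      exact isMAdicOpen_bot_of_supportDim_nonpos (by simpa using hM)
  | succ k ih =>
    obtain ⟨x, hxI, hx⟩ : ∃ x ∈ I, ∀ p ∈ (Module.annihilator R M).minimalPrimes,
        p ≠ maximalIdeal R → x ∉ p := by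
      by_contra! hcon
      let S := (Module.annihilator R M).minimalPrimes \ {maximalIdeal R}
      have hS : S.Finite := (Ideal.finite_minimalPrimes_of_isNoetherianRing R _).sdiff
      have h1 := (Ideal.subset_union_prime (s := hS.toFinset) (f := id) (I := I) ⊥ ⊥
        fun p hp _ _ => ((hS.mem_toFinset.mp hp).1.1.1)).mp fun x hx => by
          obtain ⟨p, hp, hpm, hxp⟩ := hcon x hx
          simp only [Set.mem_iUnion]
          exact ⟨p, by simpa [S] using ⟨hp, hpm⟩, hxp⟩
      obtain ⟨p, hp, hIp⟩ := h1
      obtain ⟨hp, hpm⟩ := hS.mem_toFinset.mp hp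
      exact hpm (eq_maximalIdeal_of_isMAdicOpen hI hp.1.1 hp.1.2 hIp)
    obtain ⟨J, hJI, hJ, hJM⟩ := ih (supportDim_quotient_le hM hx) (hI.quotient _)
    exact ⟨Ideal.span {x} ⊔ J, sup_le ((Ideal.span_singleton_le_iff_mem I).mpr hxI) hJI,
      hJ.span_sup x, hJM.of_quotient⟩

end Dimension

section HigherDimension

universe u v

variable {R : Type u} [CommRing R] [IsNoetherianRing R] [IsLocalRing R]

/-- The vanishing of the first Hilbert coefficient of modules of universe `v` does not depend on
the choice of an open ideal generated by `s` elements. -/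
def CoeffOneIndependent (R : Type u) [CommRing R] [IsLocalRing R] (s : ℕ) : Prop :=
  ∀ ⦃Q Q' : Ideal R⦄, GeneratedBy s Q → GeneratedBy s Q' → Q ≤ maximalIdeal R →
    Q' ≤ maximalIdeal R → ∀ ⦃M : Type v⦄ [AddCommGroup M] [Module R M] [Module.Finite R M],
    IsMAdicOpen (Q • ⊤ : Submodule R M) → IsMAdicOpen (Q' • ⊤ : Submodule R M) →
    ∀ ⦃e e' : ℕ → ℤ⦄, HasHilbPoly M Q s e → HasHilbPoly M Q' s e' → e 1 = 0 → e' 1 = 0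

variable [Infinite (ResidueField R)]

theorem CoeffOneIndependent.coeff_one_eq_zero_iff {t : ℕ} (ih : CoeffOneIndependent.{u, v} R (t + 2))
    {N : Type v} [AddCommGroup N] [Module R N] [Module.Finite R N]
    {Q Q' I : Ideal R} {a c : R} (hQm : Q ≤ maximalIdeal R) (hQm' : Q' ≤ maximalIdeal R)
    (hQN : IsMAdicOpen (Q • ⊤ : Submodule R N)) (hQN' : IsMAdicOpen (Q' • ⊤ : Submodule R N))
    (hI : GeneratedBy (t + 2) I) (hIQ : I ≤ Q) (hQ' : Q' = I ⊔ Ideal.span {c})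
    (haI : a ∈ I) (ha : IsSMulRegular N a)
    {B : Set (Ideal R)} (hB : B.Finite) (haB : ∀ W ∈ B, a ∉ W)
    (hBQ : ∀ y ∈ Q, (∀ W ∈ B, y ∉ W) →
      IsSMulRegular N y ∧ (∃ D, ∀ n ≥ D, powColon N Q y n = Q ^ n • ⊤) ∧
      ∃ J, GeneratedBy (t + 2) J ∧ Q = Ideal.span {y} ⊔ J)
    {e e' : ℕ → ℤ} (he : HasHilbPoly N Q (t + 3) e) (he' : HasHilbPoly N Q' (t + 3) e') :
    e 1 = 0 ↔ e' 1 = 0 := by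
  have hAss : ∀ p ∈ associatedPrimes R N, ¬ I ≤ p := by
    intro p hp hIp
    have : a ∈ ⋃ p ∈ associatedPrimes R N, (p : Set R) := by
      simp only [Set.mem_iUnion]
      exact ⟨p, hp, hIp haI⟩
    rw [biUnion_associatedPrimes_eq_compl_regular] at this
    exact this ha
  obtain ⟨B', hB', hIB', h'⟩ := exists_finite_superficial N hQ' hI hAss
  obtain ⟨x, hxI, hx⟩ := exists_mem_forall_notMem I (hB.union hB') (by
    rintro W (hW | hW) hIW
    exacts [haB W hW (hIW haI), hIB' W hW hIW])
  obtain ⟨-, hC, J, hJ, hQJ⟩ := hBQ x (hIQ hxI) fun W hW => hx W (Or.inl hW)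
  obtain ⟨-, hC', J', hJ', hIJ'⟩ := h' x hxI fun W hW => hx W (Or.inr hW)
  have hcQ' : c ∈ Q' := hQ' ▸ Ideal.mem_sup_right (Ideal.mem_span_singleton_self c)
  have hxQ' : x ∈ Q' := hQ' ▸ Ideal.mem_sup_left hxI
  have hQJ' : Q' = Ideal.span {x} ⊔ (Ideal.span {c} ⊔ J') := by
    rw [hQ', hIJ', sup_assoc, sup_comm J']
  have hJm := (le_sup_right.trans hQJ.ge).trans hQm
  have hJm' := (le_sup_right.trans hQJ'.ge).trans hQm'
  have hJN := hQN.quotient (Ideal.span {x} • ⊤ : Submodule R N)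
  have hJN' := hQN'.quotient (Ideal.span {x} • ⊤ : Submodule R N)
  rw [smul_top_eq_of_sup hQJ] at hJN
  rw [smul_top_eq_of_sup hQJ'] at hJN'
  have h1 := (HasHilbPoly.of_sup hQJ).mp (he.quotient_of_powColon_eq hQN hC)
  obtain ⟨f, hf⟩ := exists_hasHilbPoly (hJ'.span_sup c) hJm' hJN'
  rw [he'.eq_of_quotient_of_powColon_le hQN' hxQ' hcQ' hC' ((HasHilbPoly.of_sup hQJ').mpr hf) 1
    (by omega)]
  exact ⟨ih hJ (hJ'.span_sup c) hJm hJm' hJN hJN' h1 hf,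
    ih (hJ'.span_sup c) hJ hJm' hJm hJN' hJN hf h1⟩

theorem coeffOneIndependent (t : ℕ) : CoeffOneIndependent.{u, v} R (t + 2) := by
  induction t with
  | zero =>
    intro Q Q' hQ hQ' hQm hQm' M _ _ _ hQM hQM' e e' he he'
    exact coeff_one_eq_zero_of_generatedBy_two hQ hQ' hQm hQm' hQM hQM' he he'
  | succ t ih =>
    intro Q Q' hQ hQ' hQm hQm' M _ _ _ hQM hQM' e e' he he'
    obtain ⟨L, k, hk, hN⟩ := exists_quotient_noSocle R M
    obtain ⟨f, hf, hfe⟩ := he.quotient_finiteLength hk hQm hQM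
    obtain ⟨f', hf', hfe'⟩ := he'.quotient_finiteLength hk hQm' hQM'
    rw [← hfe 1 (by omega), ← hfe' 1 (by omega)]
    replace hQM := hQM.quotient L
    replace hQM' := hQM'.quotient L
    obtain ⟨B, hB, hQB, h⟩ := hN.exists_finite_superficial hQ hQM
    obtain ⟨a, haQ, haB⟩ := exists_mem_forall_notMem Q hB hQB
    obtain ⟨ha, -, J, hJ, hQJ⟩ := h a haQ haB
    have hJN := hQM.quotient (Ideal.span {a} • ⊤ : Submodule R (M ⧸ L))
    have hQN' := hQM'.quotient (Ideal.span {a} • ⊤ : Submodule R (M ⧸ L))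
    have hQN := hJN
    rw [smul_top_eq_of_sup hQJ] at hJN
    have hdim := hJ.supportDim_le ((le_sup_right.trans hQJ.ge).trans hQm) hJN
    obtain ⟨B', hB', hQB', h'⟩ := hN.exists_finite_superficial hQ' hQM'
    let P := (Module.annihilator R ((M ⧸ L) ⧸
      (Ideal.span {a} • ⊤ : Submodule R (M ⧸ L)))).minimalPrimes \ {maximalIdeal R}
    have hP : P.Finite := (Ideal.finite_minimalPrimes_of_isNoetherianRing R _).sdiff
    obtain ⟨c, hcQ', hc⟩ := exists_mem_forall_notMem Q' (hB'.union hP) (by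
      rintro W (hW | hW) hIW
      · exact hQB' W hW hIW
      · exact hW.2 (eq_maximalIdeal_of_isMAdicOpen hQN' hW.1.1.1 hW.1.1.2 hIW))
    have hcB' : ∀ W ∈ B', c ∉ W := fun W hW => hc W (Or.inl hW)
    obtain ⟨hcr, -⟩ := h' c hcQ' hcB'
    have hdim' := supportDim_quotient_le hdim fun p hp hpm => hc p (Or.inr ⟨hp, hpm⟩)
    obtain ⟨b, hbQ, hb, hbN⟩ := exists_generatedBy_isMAdicOpen hdim'
      ((hQN.quotient _).mul (hQN'.quotient _))
    replace hbN := hbN.of_quotient.of_quotient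
    have e1 : Ideal.span {a} ⊔ (Ideal.span {c} ⊔ b) = (Ideal.span {a} ⊔ b) ⊔ Ideal.span {c} := by
      rw [sup_assoc, sup_comm b]
    have e2 : Ideal.span {a} ⊔ (Ideal.span {c} ⊔ b) = (Ideal.span {c} ⊔ b) ⊔ Ideal.span {a} :=
      sup_comm _ _
    have hIQ : Ideal.span {a} ⊔ b ≤ Q :=
      sup_le ((Ideal.span_singleton_le_iff_mem Q).mpr haQ) (hbQ.trans Ideal.mul_le_left)
    have hIQ' : Ideal.span {c} ⊔ b ≤ Q' :=
      sup_le ((Ideal.span_singleton_le_iff_mem Q').mpr hcQ') (hbQ.trans Ideal.mul_le_right)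
    have hm : Ideal.span {a} ⊔ (Ideal.span {c} ⊔ b) ≤ maximalIdeal R :=
      sup_le ((le_sup_left.trans hIQ).trans hQm) (hIQ'.trans hQm')
    obtain ⟨g, hg⟩ := exists_hasHilbPoly ((hb.span_sup c).span_sup a) hm hbN
    rw [CoeffOneIndependent.coeff_one_eq_zero_iff ih hQm hm hQM hbN (hb.span_sup a) hIQ e1
      (Ideal.mem_sup_left (Ideal.mem_span_singleton_self a)) ha hB haB h hf hg,
      CoeffOneIndependent.coeff_one_eq_zero_iff ih hQm' hm hQM' hbN (hb.span_sup c) hIQ' e2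
      (Ideal.mem_sup_left (Ideal.mem_span_singleton_self c)) hcr hB' hcB' h' hf' hg]
    exact id

end HigherDimension

section BaseChange

universe u v w

open scoped TensorProduct

variable {R : Type u} [CommRing R]

theorem GeneratedBy.map {k : ℕ} {Q : Ideal R} (hQ : GeneratedBy k Q) {S : Type w} [CommRing S]
    (f : R →+* S) : GeneratedBy k (Q.map f) := by
  obtain ⟨x, rfl⟩ := hQ
  exact ⟨f ∘ x, by rw [Ideal.map_span, Set.range_comp]⟩

variable [IsLocalRing R] {S : Type w} [CommRing S] [IsLocalRing S] [Algebra R S] [Module.Flat R S]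
  [IsLocalHom (algebraMap R S)] {M : Type v} [AddCommGroup M] [Module R M]

theorem length_baseChange_quotient
    (hRS : (maximalIdeal R).map (algebraMap R S) = maximalIdeal S) (Q : Ideal R) :
    Module.length S ((S ⊗[R] M) ⧸ (Q.map (algebraMap R S) • ⊤ : Submodule S (S ⊗[R] M))) =
      Module.length R (M ⧸ (Q • ⊤ : Submodule R M)) := by
  rw [(TensorProduct.tensorQuotMapSMulEquivTensorQuot M S Q).length_eq,
    IsLocalRing.length_baseChange, hRS,
    (Module.length_eq_one_iff (R := S)).mpr (isSimpleModule_iff_isCoatom.mpr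
      (maximalIdeal.isMaximal S).out), mul_one]

theorem colength_pow_baseChange
    (hRS : (maximalIdeal R).map (algebraMap R S) = maximalIdeal S)
    (Q : Ideal R) (n : ℕ) :
    colength (Q.map (algebraMap R S) ^ n • ⊤ : Submodule S (S ⊗[R] M)) =
      colength (Q ^ n • ⊤ : Submodule R M) := by
  rw [← Ideal.map_pow, colength, length_baseChange_quotient hRS, colength]

theorem hasHilbPoly_baseChange_iff
    (hRS : (maximalIdeal R).map (algebraMap R S) = maximalIdeal S)
    {Q : Ideal R} {s : ℕ} {e : ℕ → ℤ} :
    HasHilbPoly (S ⊗[R] M) (Q.map (algebraMap R S)) s e ↔ HasHilbPoly M Q s e := by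
  simp only [HasHilbPoly, colength_pow_baseChange hRS]

theorem IsMAdicOpen.baseChange [IsNoetherianRing R] [IsNoetherianRing S] [Module.Finite R M]
    (hRS : (maximalIdeal R).map (algebraMap R S) = maximalIdeal S)
    {Q : Ideal R} (hQ : IsMAdicOpen (Q • ⊤ : Submodule R M)) :
    IsMAdicOpen (Q.map (algebraMap R S) • ⊤ : Submodule S (S ⊗[R] M)) := by
  rw [isMAdicOpen_iff, ← Module.length_ne_top_iff] at hQ ⊢
  rwa [length_baseChange_quotient hRS]

end BaseChange

section ResidueField

universe u

open Polynomial in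
/-- A Noetherian local ring has a flat local extension `S` with infinite residue field such that
the maximal ideal of `R` generates that of `S`. -/
theorem exists_flat_infinite_residueField (R : Type u) [CommRing R] [IsNoetherianRing R]
    [IsLocalRing R] :
    ∃ (S : Type u) (_ : CommRing S) (_ : IsLocalRing S) (_ : IsNoetherianRing S) (_ : Algebra R S),
      Module.Flat R S ∧ IsLocalHom (algebraMap R S) ∧
      (maximalIdeal R).map (algebraMap R S) = maximalIdeal S ∧ Infinite (ResidueField S) := by
  let P : Ideal R[X] := (maximalIdeal R).map C
  have hP : P.IsPrime := Ideal.isPrime_map_C_of_isPrime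
  have hmap : (maximalIdeal R).map (algebraMap R (Localization.AtPrime P)) =
      maximalIdeal (Localization.AtPrime P) := by
    rw [IsScalarTower.algebraMap_eq R R[X], ← Ideal.map_map]
    exact Localization.AtPrime.map_eq_maximalIdeal
  have : Module.Flat R[X] (Localization.AtPrime P) := IsLocalization.flat _ P.primeCompl
  refine ⟨Localization.AtPrime P, inferInstance, inferInstance,
    IsLocalization.isNoetherianRing P.primeCompl _ inferInstance, inferInstance,
    Module.Flat.trans R R[X] _, ?_, hmap, ?_⟩
  · exact ((local_hom_TFAE _).out 0 2).mpr hmap.le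
  · refine Infinite.of_injective
      (fun i : ℕ => residue (Localization.AtPrime P) (algebraMap R[X] _ (X ^ i))) fun i j hij => ?_
    by_contra hne
    simp only at hij
    rw [← sub_eq_zero, ← map_sub, ← map_sub, residue_eq_zero_iff,
      IsLocalization.AtPrime.to_map_mem_maximal_iff _ P, Ideal.mem_map_C_iff] at hij
    have := hij i
    rw [coeff_sub, coeff_X_pow_self, coeff_X_pow, if_neg hne, sub_zero] at this
    exact (Ideal.ne_top_iff_one _).mp (maximalIdeal.isMaximal R).ne_top this

end ResidueField

section ParameterIdeals

universe u v

variable {R : Type u} [CommRing R] [IsNoetherianRing R] [IsLocalRing R] {M : Type v}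
  [AddCommGroup M] [Module R M] [Module.Finite R M]

theorem isParameterIdealFor_iff {s : ℕ} {Q : Ideal R} :
    IsParameterIdealFor M s Q ↔
      GeneratedBy s Q ∧ Q ≤ maximalIdeal R ∧ IsMAdicOpen (Q • ⊤ : Submodule R M) := by
  rw [isMAdicOpen_iff, ← Module.length_ne_top_iff, IsParameterIdealFor, ← and_assoc]
  refine and_congr ⟨?_, ?_⟩ ?_
  · rintro ⟨x, hx, rfl⟩
    exact ⟨⟨x, rfl⟩, Ideal.span_le.mpr (by rintro _ ⟨i, rfl⟩; exact hx i)⟩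
  · rintro ⟨⟨x, rfl⟩, hx⟩
    exact ⟨x, fun i => hx (Ideal.subset_span ⟨i, rfl⟩), rfl⟩
  · simp only [moduleLength, ← Module.coe_length, ENat.ne_top_iff_exists]
    constructor
    · rintro ⟨l, hl⟩
      exact ⟨l, (WithBot.coe_injective hl).symm⟩
    · rintro ⟨l, hl⟩
      exact ⟨l, by rw [← hl]; rfl⟩

end ParameterIdeals

/-- **Ghezzi–Goto–Hong–Ozeki–Phuong–Vasconcelos; Theorem 3.7** (Vasconcelos modules).
Let `(R,m)` be a Noetherian local ring and `M` a finitely generated `R`-module of dimension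
`s ≥ 2`.  Then `e₁(Q,M) = 0` for some parameter ideal `Q` for `M` iff `e₁(Q,M) = 0` for
every parameter ideal `Q` for `M`. -/
theorem vasconcelos_module_some_iff_all
    {R M : Type*} [CommRing R] [IsNoetherianRing R] [IsLocalRing R]
    [AddCommGroup M] [Module R M] [Module.Finite R M]
    (s : ℕ) (hs : 2 ≤ s)
    (hdimM : ringKrullDim (R ⧸ Module.annihilator R M) = s) :
    (∃ Q : Ideal R, IsParameterIdealFor M s Q ∧
        ∃ e : ℕ → ℤ, HasHilbertCoeffsMod M Q s e ∧ e 1 = 0) ↔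
      (∀ Q : Ideal R, IsParameterIdealFor M s Q →
        ∀ e : ℕ → ℤ, HasHilbertCoeffsMod M Q s e → e 1 = 0) := by
  obtain ⟨S, _, _, _, _, _, _, hRS, _⟩ := exists_flat_infinite_residueField R
  constructor
  · rintro ⟨Q, hQ, e, he, h0⟩ Q' hQ' e' he'
    obtain ⟨hQ, hQm, hQM⟩ := isParameterIdealFor_iff.mp hQ
    obtain ⟨hQ', hQm', hQM'⟩ := isParameterIdealFor_iff.mp hQ'
    rw [hasHilbertCoeffsMod_iff hQM, ← hasHilbPoly_baseChange_iff hRS] at he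
    rw [hasHilbertCoeffsMod_iff hQM', ← hasHilbPoly_baseChange_iff hRS] at he'
    obtain ⟨t, rfl⟩ := Nat.exists_eq_add_of_le' hs
    exact coeffOneIndependent t (hQ.map _) (hQ'.map _) ((Ideal.map_mono hQm).trans hRS.le)
      ((Ideal.map_mono hQm').trans hRS.le) (hQM.baseChange hRS) (hQM'.baseChange hRS) he he' h0
  · intro h
    rw [← Module.supportDim_eq_ringKrullDim_quotient_annihilator] at hdimM
    obtain ⟨Q, hQm, hQ, hQM⟩ := exists_generatedBy_isMAdicOpen hdimM.le
      (I := maximalIdeal R) ⟨1, by rw [pow_one]⟩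
    obtain ⟨e, he⟩ := exists_hasHilbPoly (hQ.map _) ((Ideal.map_mono hQm).trans hRS.le)
      (hQM.baseChange hRS)
    rw [hasHilbPoly_baseChange_iff hRS, ← hasHilbertCoeffsMod_iff hQM] at he
    have hQ := isParameterIdealFor_iff.mpr ⟨hQ, hQm, hQM⟩
    exact ⟨Q, hQ, e, he, h Q hQ e he⟩
end

section
/- Let (R,m) be a Noetherian local ring of dimension 2 with depth(R) > 0, and let Q = (a_1,a_2) be a parameter ideal of R such that a_1 is superficial with respect to Q. Then −λ(H^1_m(R)) ≤ e_2(Q) ≤ 0. Moreover, e_2(Q) = 0 if and only if a_1, a_2 forms a d-sequence in R. -/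
universe u

open Finset IsLocalRing CategoryTheory

/-- `e 0, …, e d` are the Hilbert coefficients of an ideal `I` in a ring of dimension `d`:
for all large `n`, `λ(R ⧸ I^(n+1)) = ∑_{i=0}^{d} (-1)^i (e i) C(n+d-i, d-i)`. -/
def HasHilbertCoeffs {R : Type*} [CommRing R] (I : Ideal R) (d : ℕ) (e : ℕ → ℤ) : Prop :=
  ∃ N : ℕ, ∀ n ≥ N, ∃ l : ℕ,
    moduleLength R (R ⧸ I ^ (n + 1)) = (l : WithBot ℕ∞) ∧
    (l : ℤ) = ∑ i ∈ Finset.range (d + 1), (-1 : ℤ) ^ i * e i * ((n + d - i).choose (d - i))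

/-- The length of the `i`-th local cohomology module `Hⁱ_m(M)`. -/
noncomputable def localCohomologyLength (R M : Type u) [CommRing R] [IsLocalRing R]
    [AddCommGroup M] [Module R M] (i : ℕ) : WithBot ℕ∞ :=
  moduleLength R ((localCohomology (maximalIdeal R) i).obj (ModuleCat.of R M))

/-- A sequence `x₁, …, x_m` is a d-sequence if
`((x₁,…,x_i) : x_{i+1}x_k) = ((x₁,…,x_i) : x_k)` for all `0 ≤ i ≤ m-1`, `k ≥ i+1`. -/
def IsDSequence {R : Type*} [CommRing R] {m : ℕ} (x : Fin m → R) : Prop :=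
  ∀ i k : Fin m, i ≤ k →
    (Ideal.span (x '' {j | j < i})).colon (Ideal.span {x i * x k}) =
      (Ideal.span (x '' {j | j < i})).colon (Ideal.span {x k})

/-- `a` is superficial with respect to `Q`: there is `c ≥ 0` with
`(Q^(n+1) : a) ∩ Q^c = Q^n` for all `n ≥ c`. -/
def IsSuperficial {R : Type*} [CommRing R] (Q : Ideal R) (a : R) : Prop :=
  ∃ c : ℕ, ∀ n ≥ c, (Q ^ (n + 1)).colon (Ideal.span {a}) ⊓ Q ^ c = Q ^ n

noncomputable section

lemma CategoryTheory.conj_iso_trans {D : Type*} [Category* D] {A₁ A₂ B₁ B₂ C₁ C₂ : D}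
    (p : A₁ ≅ B₁) (q : A₂ ≅ B₂) (i : B₁ ≅ C₁) (j : B₂ ≅ C₂) (m : B₁ ⟶ B₂) (n : C₁ ⟶ C₂)
    (h : m ≫ j.hom = i.hom ≫ n) :
    (p.hom ≫ m ≫ q.inv) ≫ (q ≪≫ j).hom = (p ≪≫ i).hom ≫ n := by
  simp [h]

section

variable {C D : Type*} [Category* C] [Category* D] [Abelian C] [HasProjectiveResolutions C]
  [Abelian D]

/-- The first left derived functor, computed from the three lowest terms of a projective
resolution. -/
def CategoryTheory.ProjectiveResolution.isoLeftDerivedOneObj {X : C} (P : ProjectiveResolution X)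
    (F : C ⥤ D) [F.Additive] :
    (F.leftDerived 1).obj X ≅
      (((F.mapHomologicalComplex _).obj P.complex).sc' 2 1 0).homology :=
  P.isoLeftDerivedObj F 1 ≪≫ ShortComplex.homologyMapIso
    ((HomologicalComplex.natIsoSc' D _ 2 1 0 (by simp) (by simp)).app _)

lemma CategoryTheory.ProjectiveResolution.isoLeftDerivedOneObj_inv_naturality {X Y : C} (f : X ⟶ Y)
    {P : ProjectiveResolution X} {Q : ProjectiveResolution Y} (g : P.complex ⟶ Q.complex)
    (w : g ≫ Q.π = P.π ≫ (ChainComplex.single₀ C).map f) (F : C ⥤ D) [F.Additive] :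
    (P.isoLeftDerivedOneObj F).inv ≫ (F.leftDerived 1).map f =
      ShortComplex.homologyMap ((HomologicalComplex.shortComplexFunctor' D _ 2 1 0).map
        ((F.mapHomologicalComplex _).map g)) ≫ (Q.isoLeftDerivedOneObj F).inv := by
  rw [Iso.inv_comp_eq, ← Category.assoc, Iso.eq_comp_inv, F.leftDerived_map_eq 1 f g w]
  have h := congrArg (ShortComplex.homologyFunctor D).map
    ((HomologicalComplex.natIsoSc' D (ComplexShape.down ℕ) 2 1 0
      (by simp) (by simp)).hom.naturality ((F.mapHomologicalComplex _).map g))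
  rw [Functor.map_comp, Functor.map_comp] at h
  exact conj_iso_trans (P.isoLeftDerivedObj F 1) (Q.isoLeftDerivedObj F 1)
    (ShortComplex.homologyMapIso
      ((HomologicalComplex.natIsoSc' D _ 2 1 0 (by simp) (by simp)).app _))
    (ShortComplex.homologyMapIso
      ((HomologicalComplex.natIsoSc' D _ 2 1 0 (by simp) (by simp)).app _)) _ _ h

end

variable {R : Type u} [CommRing R]

/-- The complex `Hom(P₀, Y) → Hom(P₁, Y) → Hom(P₂, Y)`. -/
abbrev homSC {X : ModuleCat.{u} R} (P : ProjectiveResolution X) (Y : ModuleCat.{u} R) :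
    ShortComplex (ModuleCat.{u} R) :=
  ((((linearYoneda R (ModuleCat.{u} R)).obj Y).rightOp.mapHomologicalComplex _).obj
    P.complex |>.sc' 2 1 0).unop

/-- The map of complexes of homomorphisms into `Y` induced by a chain map of resolutions. -/
abbrev homSCMap {X X' : ModuleCat.{u} R} {P : ProjectiveResolution X}
    {P' : ProjectiveResolution X'} (g : P'.complex ⟶ P.complex) (Y : ModuleCat.{u} R) :
    homSC P Y ⟶ homSC P' Y :=
  ShortComplex.unopMap ((HomologicalComplex.shortComplexFunctor' _ _ 2 1 0).map
    ((((linearYoneda R (ModuleCat.{u} R)).obj Y).rightOp.mapHomologicalComplex _).map g))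

/-- `Ext¹(X, Y)` as the middle cohomology of `Hom(P, Y)`, for a projective resolution `P` of `X`. -/
def extIso {X : ModuleCat.{u} R} (P : ProjectiveResolution X) (Y : ModuleCat.{u} R) :
   ((Ext R (ModuleCat.{u} R) 1).obj (Opposite.op X)).obj Y ≅ (homSC P Y).homology :=
  (P.isoLeftDerivedOneObj ((linearYoneda R (ModuleCat.{u} R)).obj Y).rightOp).unop.symm ≪≫
    (ShortComplex.homologyOpIso (homSC P Y)).symm.unop

lemma extIso_naturality {X X' : ModuleCat.{u} R} (p : X' ⟶ X) {P : ProjectiveResolution X}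
    {P' : ProjectiveResolution X'} (g : P'.complex ⟶ P.complex)
    (w : g ≫ P.π = P'.π ≫ (ChainComplex.single₀ _).map p) (Y : ModuleCat.{u} R) :
    (((Ext R (ModuleCat.{u} R) 1).map p.op).app Y) ≫ (extIso P' Y).hom =
      (extIso P Y).hom ≫ ShortComplex.homologyMap (homSCMap g Y) := by
  apply Quiver.Hom.op_inj
  have h1 := ProjectiveResolution.isoLeftDerivedOneObj_inv_naturality p g w
    ((linearYoneda R (ModuleCat.{u} R)).obj Y).rightOp
  have h2 := ShortComplex.homologyOpIso_inv_naturality (homSCMap g Y)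
  change ((homSC P' Y).homologyOpIso.inv ≫
      (P'.isoLeftDerivedOneObj ((linearYoneda R (ModuleCat.{u} R)).obj Y).rightOp).inv) ≫
        (((linearYoneda R (ModuleCat.{u} R)).obj Y).rightOp.leftDerived 1).map p =
    (ShortComplex.homologyMap (homSCMap g Y)).op ≫ (homSC P Y).homologyOpIso.inv ≫
      (P.isoLeftDerivedOneObj ((linearYoneda R (ModuleCat.{u} R)).obj Y).rightOp).inv
  refine (Category.assoc _ _ _).trans
    ((congrArg ((homSC P' Y).homologyOpIso.inv ≫ ·) h1).trans ?_)
  refine (Category.assoc _ _ _).symm.trans ((congrArg (· ≫ (P.isoLeftDerivedOneObj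
    ((linearYoneda R (ModuleCat.{u} R)).obj Y).rightOp).inv) h2.symm).trans (Category.assoc _ _ _))

/-- The homology class of a cycle. -/
def homClass (S : ShortComplex (ModuleCat.{u} R)) : LinearMap.ker S.g.hom →ₗ[R] S.homology :=
  (S.moduleCatCyclesIso.inv ≫ S.homologyπ).hom

lemma homClass_surjective (S : ShortComplex (ModuleCat.{u} R)) :
    Function.Surjective (homClass S) :=
  (ModuleCat.epi_iff_surjective (S.moduleCatCyclesIso.inv ≫ S.homologyπ)).1 inferInstance

lemma homClass_eq_zero (S : ShortComplex (ModuleCat.{u} R)) (z : LinearMap.ker S.g.hom) :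
    homClass S z = 0 ↔ ∃ w, S.f w = z := by
  have h : homClass S z = S.moduleCatHomologyIso.inv (S.moduleCatLeftHomologyData.π z) := by
    unfold homClass
    rw [ShortComplex.moduleCatCyclesIso_inv_π]
    rfl
  rw [h, map_eq_zero_iff _ ((ModuleCat.mono_iff_injective _).1 inferInstance)]
  refine (Submodule.Quotient.mk_eq_zero _).trans ?_
  simp only [LinearMap.mem_range, Subtype.ext_iff]
  rfl

lemma homologyMap_homClass {S T : ShortComplex (ModuleCat.{u} R)} (φ : S ⟶ T)
    (z : LinearMap.ker S.g.hom) :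
    ShortComplex.homologyMap φ (homClass S z) = homClass T ⟨φ.τ₂ z, by
      have := congr($(φ.comm₂₃) z)
      have hz : S.g z = 0 := z.2
      simpa [hz] using this⟩ := by
  have hz : φ.τ₂ z ∈ LinearMap.ker T.g.hom := by
    have := congr($(φ.comm₂₃) z)
    have hz : S.g z = 0 := z.2
    simpa [hz] using this
  have h2 : ShortComplex.cyclesMap φ (S.moduleCatCyclesIso.inv z) =
      T.moduleCatCyclesIso.inv (⟨φ.τ₂ z, hz⟩ : LinearMap.ker T.g.hom) := by
    apply (ModuleCat.mono_iff_injective T.iCycles).1 inferInstance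
    have e1 := congr($(ShortComplex.cyclesMap_i φ) (S.moduleCatCyclesIso.inv z))
    have e2 := congr($(S.moduleCatCyclesIso_inv_iCycles) z)
    have e3 := congr($(T.moduleCatCyclesIso_inv_iCycles) (⟨φ.τ₂ z, hz⟩ : LinearMap.ker T.g.hom))
    exact e1.trans ((congrArg φ.τ₂ e2).trans e3.symm)
  have h3 := congr($(ShortComplex.homologyπ_naturality φ) (S.moduleCatCyclesIso.inv z))
  exact h3.trans (congrArg T.homologyπ h2)

lemma mono_homologyMap_of {S T : ShortComplex (ModuleCat.{u} R)} (φ : S ⟶ T)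
    (h : ∀ z : S.X₂, S.g z = 0 → (∃ w : T.X₁, T.f w = φ.τ₂ z) → ∃ w, S.f w = z) :
    Mono (ShortComplex.homologyMap φ) := by
  rw [ModuleCat.mono_iff_injective, injective_iff_map_eq_zero]
  intro c hc
  obtain ⟨c, rfl⟩ := homClass_surjective _ c
  rw [homologyMap_homClass, homClass_eq_zero] at hc
  rw [homClass_eq_zero]
  exact h c c.2 hc

section

variable {P₀ P₁ P₂ P₀' P₁' Y : Type*} [AddCommGroup P₀] [AddCommGroup P₁] [AddCommGroup P₂]
  [AddCommGroup P₀'] [AddCommGroup P₁'] [AddCommGroup Y] [Module R P₀] [Module R P₁] [Module R P₂]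
  [Module R P₀'] [Module R P₁'] [Module R Y]

lemma exists_extension_of_chain_map (d₁ : P₁ →ₗ[R] P₀) (d₂ : P₂ →ₗ[R] P₁) (d₁' : P₁' →ₗ[R] P₀')
    (g₀ : P₀' →ₗ[R] P₀) (g₁ : P₁' →ₗ[R] P₁) (hg : ∀ q, g₀ (d₁' q) = d₁ (g₁ q))
    (hsurj : ∀ y, ∃ p q, g₀ p + d₁ q = y) (z : R) (hz : ∀ p, ∃ q, d₁' q = z • p)
    (hex : ∀ q, d₁ q = 0 → ∃ r, d₂ r = q) (hzY : ∀ y : Y, z • y = 0 → y = 0)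
    (φ : P₁ →ₗ[R] Y) (hφ : ∀ r, φ (d₂ r) = 0) (ψ' : P₀' →ₗ[R] Y)
    (hψ' : ∀ q, ψ' (d₁' q) = φ (g₁ q)) : ∃ ψ : P₀ →ₗ[R] Y, ∀ q, ψ (d₁ q) = φ q := by
  have hF : Function.Surjective (g₀.coprod d₁) := fun y => by
    obtain ⟨p, q, h⟩ := hsurj y
    exact ⟨(p, q), by simpa using h⟩
  have hker : LinearMap.ker (g₀.coprod d₁) ≤ LinearMap.ker (ψ'.coprod φ) := by
    rintro ⟨p, q⟩ h
    simp only [LinearMap.mem_ker, LinearMap.coprod_apply] at h ⊢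
    obtain ⟨q', hq'⟩ := hz p
    obtain ⟨r, hr⟩ := hex (g₁ q' + z • q) (by
      rw [map_add, ← hg, hq', map_smul, map_smul, ← smul_add, h, smul_zero])
    apply hzY
    rw [smul_add, ← map_smul, ← hq', hψ', ← map_smul, ← map_add, ← hr, hφ]
  refine ⟨(LinearMap.ker _).liftQ _ hker ∘ₗ
    ((g₀.coprod d₁).quotKerEquivOfSurjective hF).symm.toLinearMap, fun q => ?_⟩
  have : ((g₀.coprod d₁).quotKerEquivOfSurjective hF).symm (d₁ q) =
      Submodule.Quotient.mk (0, q) := by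
    rw [LinearEquiv.symm_apply_eq]
    simp
  simp [this]

lemma exists_cocycle (d₁ : P₁ →ₗ[R] P₀) (l : P₀ →ₗ[R] R) (T J : Ideal R) (x : R)
    (hx : x ∈ nonZeroDivisors R) (hl : ∀ q, l (d₁ q) ∈ J)
    (hT : ∀ t ∈ T, ∀ j ∈ J, t * j ∈ Ideal.span {x}) :
    ∃ c : T →ₗ[R] (P₁ →ₗ[R] R), ∀ t q, x * c t q = t * l (d₁ q) := by
  have h : ∀ (t : T) q, ∃ y, x * y = t * l (d₁ q) := fun t q => by
    obtain ⟨y, hy⟩ := Ideal.mem_span_singleton.1 (hT t t.2 _ (hl q))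
    exact ⟨y, hy.symm⟩
  choose f hf using h
  have hc : ∀ {u v}, x * u = x * v → u = v := fun h => (mul_cancel_left_mem_nonZeroDivisors hx).1 h
  refine ⟨LinearMap.mk₂ R f ?_ ?_ ?_ ?_, fun t q => hf t q⟩
  · intro s t q
    apply hc
    rw [mul_add, hf, hf, hf]
    push_cast
    ring
  · intro r t q
    apply hc
    rw [mul_smul_comm, hf, hf]
    simp [mul_assoc]
  · intro s t q
    apply hc
    rw [mul_add, hf, hf, hf]
    simp [mul_add]
  · intro r t q
    apply hc
    rw [mul_smul_comm, hf, hf]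
    simp [mul_left_comm]

lemma mem_span_of_cocycle_eq_boundary (d₁ : P₁ →ₗ[R] P₀) (l ψ : P₀ →ₗ[R] R) (c : P₁ →ₗ[R] R)
    (J : Ideal R) (x t z : R) (hz : z ∈ nonZeroDivisors R) (hT : ∀ j ∈ J, t * j ∈ Ideal.span {x})
    (hc : ∀ q, x * c q = t * l (d₁ q)) (hψ : ∀ q, ψ (d₁ q) = c q)
    (p : P₀) (hp : l p - 1 ∈ J) (hzp : ∃ q, d₁ q = z • p) : t ∈ Ideal.span {x} := by
  obtain ⟨q, hq⟩ := hzp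
  have h1 : t * l p = x * ψ p := by
    apply (mul_cancel_left_mem_nonZeroDivisors hz).1
    have := hc q
    rw [← hψ, hq, map_smul, map_smul, smul_eq_mul, smul_eq_mul] at this
    linear_combination -this
  have h2 := hT _ hp
  have h3 : t = x * ψ p - t * (l p - 1) := by linear_combination h1
  rw [h3]
  exact sub_mem (Ideal.mul_mem_right _ _ (Ideal.mem_span_singleton_self x)) h2

end

lemma mono_ext_one_map {X X' : ModuleCat.{u} R} (p : X' ⟶ X) (hp : Function.Surjective p)
    (Y : ModuleCat.{u} R) (z : R) (hz : ∀ x : X', z • x = 0) (hzY : ∀ y : Y, z • y = 0 → y = 0) :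
    Mono (((Ext R (ModuleCat.{u} R) 1).map p.op).app Y) := by
  let P := projectiveResolution X
  let P' := projectiveResolution X'
  let g := ProjectiveResolution.lift p P' P
  have hg0 : ∀ y, P.π.f 0 (g.f 0 y) = p (P'.π.f 0 y) := fun y =>
    congr($(ProjectiveResolution.lift_commutes_zero p P' P) y)
  have key : Mono (ShortComplex.homologyMap (homSCMap (P := P) (P' := P') g Y)) := by
    apply mono_homologyMap_of
    intro φ hφ ⟨ψ', hψ'⟩
    have hπ : Function.Surjective (P'.π.f 0) :=
      (ModuleCat.epi_iff_surjective (P'.π.f 0)).1 inferInstance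
    have hφ' : P.complex.d 2 1 ≫ φ = 0 := hφ
    have hψ'' : P'.complex.d 1 0 ≫ ψ' = g.f 1 ≫ φ := hψ'
    have ex0 := (ShortComplex.moduleCat_exact_iff _).1 P.exact₀
    have ex0' := (ShortComplex.moduleCat_exact_iff _).1 P'.exact₀
    have ex1 := (ShortComplex.moduleCat_exact_iff _).1 (P.exact_succ 0)
    have hsurj : ∀ y, ∃ p' q, g.f 0 p' + P.complex.d 1 0 q = y := fun y => by
      obtain ⟨x, hx⟩ := hp (P.π.f 0 y)
      obtain ⟨p', rfl⟩ := hπ x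
      obtain ⟨q, hq⟩ := ex0 (y - g.f 0 p') (by
        change P.π.f 0 _ = 0
        rw [map_sub, hg0, hx, sub_self])
      refine ⟨p', q, ?_⟩
      have : P.complex.d 1 0 q = y - g.f 0 p' := hq
      rw [this]
      abel
    have hz' : ∀ p', ∃ q, P'.complex.d 1 0 q = z • p' := fun p' => ex0' (z • p') (by
      change P'.π.f 0 _ = 0
      rw [map_smul]
      exact hz _)
    obtain ⟨ψ, hψ⟩ := exists_extension_of_chain_map (P.complex.d 1 0).hom (P.complex.d 2 1).hom
      (P'.complex.d 1 0).hom (g.f 0).hom (g.f 1).hom (fun q => congr($((g.comm 1 0).symm) q))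
      hsurj z hz' (fun q hq => ex1 q hq) hzY φ.hom (fun r => congr($hφ' r)) ψ'.hom
      (fun r => congr($hψ'' r))
    refine ⟨ModuleCat.ofHom ψ, ?_⟩
    change P.complex.d 1 0 ≫ ModuleCat.ofHom ψ = φ
    ext q
    exact hψ q
  have := extIso_naturality p g (ProjectiveResolution.lift_commutes p P' P) Y
  have h2 : ((Ext R (ModuleCat.{u} R) 1).map p.op).app Y =
      (extIso P Y).hom ≫ ShortComplex.homologyMap (homSCMap g Y) ≫ (extIso P' Y).inv := by
    rw [← Category.assoc, Iso.eq_comp_inv, this]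
  rw [h2]
  infer_instance

lemma exists_linearMap_ext_one (T J : Ideal R) (x z : R) (hx : x ∈ nonZeroDivisors R)
    (hz : z ∈ nonZeroDivisors R) (hzJ : z ∈ J) (hT : ∀ t ∈ T, ∀ j ∈ J, t * j ∈ Ideal.span {x}) :
    ∃ f : T →ₗ[R] ((Ext R (ModuleCat.{u} R) 1).obj (Opposite.op (ModuleCat.of R (R ⧸ J)))).obj
      (ModuleCat.of R R), ∀ t, f t = 0 → (t : R) ∈ Ideal.span {x} := by
  let P := projectiveResolution (ModuleCat.of R (R ⧸ J))
  have hπ : Function.Surjective (P.π.f 0) :=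
    (ModuleCat.epi_iff_surjective (P.π.f 0)).1 inferInstance
  let π₀ : P.complex.X 0 ⟶ ModuleCat.of R (R ⧸ J) := P.π.f 0
  have : Epi (ModuleCat.ofHom J.mkQ) :=
    (ModuleCat.epi_iff_surjective (ModuleCat.ofHom J.mkQ)).2 J.mkQ_surjective
  let l : P.complex.X 0 ⟶ ModuleCat.of R R :=
    Projective.factorThru π₀ (ModuleCat.ofHom J.mkQ)
  have hl : ∀ y, J.mkQ (l y) = P.π.f 0 y := fun y =>
    congr($(Projective.factorThru_comp π₀ (ModuleCat.ofHom J.mkQ)) y)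
  have hd : ∀ q, P.π.f 0 (P.complex.d 1 0 q) = 0 := fun q =>
    congr($(P.complex_d_comp_π_f_zero) q)
  have hdd : ∀ r, P.complex.d 1 0 (P.complex.d 2 1 r) = 0 := fun r =>
    congr($(P.complex.d_comp_d 2 1 0) r)
  obtain ⟨c, hc⟩ := exists_cocycle (P.complex.d 1 0).hom l.hom T J x hx (fun q => by
    rw [← Submodule.Quotient.mk_eq_zero]
    exact (hl _).trans (hd q)) hT
  let k : T →ₗ[R] LinearMap.ker (homSC P (ModuleCat.of R R)).g.hom :=
    { toFun := fun t => ⟨(ModuleCat.ofHom (c t) : P.complex.X 1 ⟶ ModuleCat.of R R), by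
        change P.complex.d 2 1 ≫ ModuleCat.ofHom (c t) = 0
        ext r
        apply (mul_cancel_left_mem_nonZeroDivisors hx).1
        refine (hc t _).trans ?_
        change _ * l (P.complex.d 1 0 (P.complex.d 2 1 r)) = _
        rw [hdd, map_zero, mul_zero]
        exact (mul_zero x).symm⟩
      map_add' := fun s t => by
        apply Subtype.ext
        change (ModuleCat.ofHom (c (s + t)) : P.complex.X 1 ⟶ ModuleCat.of R R) =
          ModuleCat.ofHom (c s) + ModuleCat.ofHom (c t)
        rw [map_add]
        rfl
      map_smul' := fun r t => by
        apply Subtype.ext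
        change (ModuleCat.ofHom (c (r • t)) : P.complex.X 1 ⟶ ModuleCat.of R R) =
          r • ModuleCat.ofHom (c t)
        rw [map_smul]
        rfl }
  refine ⟨(extIso P (ModuleCat.of R R)).inv.hom ∘ₗ homClass _ ∘ₗ k, fun t ht => ?_⟩
  have h0 : homClass _ (k t) = 0 := by
    apply (ModuleCat.mono_iff_injective (extIso P (ModuleCat.of R R)).inv).1 inferInstance
    exact ht.trans (map_zero _).symm
  obtain ⟨ψ, hψ⟩ := (homClass_eq_zero _ _).1 h0
  have hψ' : P.complex.d 1 0 ≫ ψ = ModuleCat.ofHom (c t) := hψ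
  obtain ⟨p, hp⟩ := hπ (J.mkQ 1)
  have ex0 := (ShortComplex.moduleCat_exact_iff _).1 P.exact₀
  refine mem_span_of_cocycle_eq_boundary (P.complex.d 1 0).hom l.hom
    (ModuleCat.Hom.hom (A := P.complex.X 0) (B := ModuleCat.of R R) ψ) (c t) J x t z
    hz (hT t t.2) (hc t) (fun q => congr($hψ' q)) p ?_ (ex0 (z • p) ?_)
  · rw [← Submodule.Quotient.mk_eq_zero]
    change J.mkQ (l p - 1) = 0
    rw [map_sub, hl, hp, sub_self]
  · change π₀ _ = 0
    have hp' : π₀ p = J.mkQ 1 := hp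
    rw [map_smul, hp']
    change z • J.mkQ 1 = 0
    rw [← map_smul]
    exact (Submodule.Quotient.mk_eq_zero _).2 (by simpa using hzJ)

lemma exists_linearMap_localCohomology_one (I T : Ideal R) (k : ℕ) (x z : R)
    (hx : x ∈ nonZeroDivisors R) (hz : z ∈ nonZeroDivisors R) (hzI : z ∈ I)
    (hT : ∀ t ∈ T, ∀ j ∈ I ^ k, t * j ∈ Ideal.span {x}) :
    ∃ f : T →ₗ[R] (localCohomology I 1).obj (ModuleCat.of R R),
      ∀ t, f t = 0 → (t : R) ∈ Ideal.span {x} := by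
  obtain ⟨f, hf⟩ := exists_linearMap_ext_one T (I ^ k) x (z ^ k) hx (pow_mem hz k)
    (Ideal.pow_mem_pow hzI k) hT
  let D := localCohomology.diagram (localCohomology.idealPowersDiagram I) 1
  let E := (evaluation (ModuleCat.{u} R) (ModuleCat.{u} R)).obj (ModuleCat.of R R)
  have hcol := Limits.isColimitOfPreserves E (Limits.colimit.isColimit D)
  have hm : Mono ((E.mapCocone (Limits.colimit.cocone D)).ι.app (Opposite.op (Opposite.op k))) := by
    have : ∀ {i j : ℕᵒᵖᵒᵖ} (φ : i ⟶ j), Mono ((D ⋙ E).map φ) := by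
      intro i j φ
      refine mono_ext_one_map ((localCohomology.ringModIdeals
        (localCohomology.idealPowersDiagram I)).map φ.unop) ?_ _ (z ^ (j.unop.unop)) ?_ ?_
      · rintro ⟨r⟩
        exact ⟨Submodule.Quotient.mk r, rfl⟩
      · rintro ⟨r⟩
        exact (Submodule.Quotient.mk_eq_zero _).2
          (Ideal.mul_mem_right _ _ (Ideal.pow_mem_pow hzI _))
      · intro y hy
        exact (mul_left_mem_nonZeroDivisors_eq_zero_iff (pow_mem hz _)).1 hy
    have : AB5OfSize.{0, 0} (ModuleCat.{u} R) := AB5OfSize_shrink.{0, 0, u, u} (ModuleCat.{u} R)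
    have : HasExactColimitsOfShape (Under (Opposite.op (Opposite.op k))) (ModuleCat.{u} R) :=
      AB5OfSize.ofShape _
    exact Limits.IsColimit.mono_ι_app_of_isFiltered hcol _
  refine ⟨ModuleCat.Hom.hom ((Limits.colimit.ι D (Opposite.op (Opposite.op k))).app
    (ModuleCat.of R R)) ∘ₗ f, fun t ht => hf t ?_⟩
  exact (ModuleCat.mono_iff_injective _).1 hm (ht.trans (map_zero _).symm)

lemma Ideal.mem_colon_span_singleton' {I : Ideal R} {a y : R} :
    y ∈ I.colon (Ideal.span {a}) ↔ y * a ∈ I := by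
  rw [Submodule.mem_colon]
  refine ⟨fun h => h a (Ideal.mem_span_singleton_self a), fun h s hs => ?_⟩
  obtain ⟨u, rfl⟩ := Ideal.mem_span_singleton.1 hs
  rw [smul_eq_mul, ← mul_assoc]
  exact I.mul_mem_right _ h

lemma IsSuperficial.exists_mem_pow {Q : Ideal R} {a : R} (h : IsSuperficial Q a) :
    ∃ c : ℕ, ∀ n ≥ c, ∀ y ∈ Q ^ c, a * y ∈ Q ^ (n + 1) → y ∈ Q ^ n := by
  obtain ⟨c, hc⟩ := h
  refine ⟨c, fun n hn y hy hay => ?_⟩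
  rw [← hc n hn]
  exact ⟨Ideal.mem_colon_span_singleton'.2 (by rwa [mul_comm]), hy⟩

lemma IsSuperficial.mem_nonZeroDivisors [IsNoetherianRing R] [IsLocalRing R] {Q : Ideal R} {a x : R}
    (h : IsSuperficial Q a) (hQ : Q ≠ ⊤) (hxQ : x ∈ Q) (hx : x ∈ nonZeroDivisors R) :
    a ∈ nonZeroDivisors R := by
  obtain ⟨c, hc⟩ := h.exists_mem_pow
  rw [mem_nonZeroDivisors_iff_left]
  intro y hy
  have hxc := Ideal.pow_mem_pow hxQ c
  have h0 : y * x ^ c ∈ (⨅ n : ℕ, Q ^ n) := by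
    rw [Submodule.mem_iInf]
    intro n
    refine Ideal.pow_le_pow_right (le_max_left n c) (hc _ (le_max_right n c) _
      (Ideal.mul_mem_left _ _ hxc) ?_)
    rw [← mul_assoc, hy, zero_mul]
    exact zero_mem _
  rw [Ideal.iInf_pow_eq_bot_of_isLocalRing Q hQ, Ideal.mem_bot] at h0
  exact (mul_right_mem_nonZeroDivisors_eq_zero_iff (pow_mem hx c)).1 h0

lemma IsSuperficial.exists_forall_mem_pow [IsNoetherianRing R] {Q : Ideal R} {a : R}
    (h : IsSuperficial Q a) (ha : a ∈ nonZeroDivisors R) :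
    ∃ c : ℕ, ∀ n ≥ c, ∀ N y, a ^ N * y ∈ Q ^ (n + N) → y ∈ Q ^ n := by
  obtain ⟨c, hc⟩ := h.exists_mem_pow
  obtain ⟨k, hk⟩ := Q.exists_pow_inf_eq_pow_smul (M := R) (Ideal.span {a})
  have key : ∀ n ≥ k + c, ∀ y, a * y ∈ Q ^ (n + 1) → y ∈ Q ^ n := by
    intro n hn y hy
    refine hc n (by lia) y ?_ hy
    have h1 : a * y ∈ Q ^ (n + 1) • (⊤ : Submodule R R) ⊓ Ideal.span {a} :=
      ⟨by simpa using hy, Ideal.mul_mem_right _ _ (Ideal.mem_span_singleton_self a)⟩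
    rw [hk (n + 1) (by lia)] at h1
    have h2 : a * y ∈ Q ^ c * Ideal.span {a} :=
      Submodule.smul_mono (Ideal.pow_le_pow_right (by lia)) inf_le_right h1
    obtain ⟨w, hw, hwa⟩ := Ideal.mem_mul_span_singleton.1 h2
    have : w = y := (mul_cancel_left_mem_nonZeroDivisors ha).1 (by rw [← hwa, mul_comm])
    exact this ▸ hw
  refine ⟨k + c, fun n hn N => ?_⟩
  induction N with
  | zero => intro y hy; simpa using hy
  | succ N ih =>
    intro y hy
    exact ih y (key (n + N) (by lia) _ (by rwa [← mul_assoc, ← pow_succ']))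

lemma isDSequence_pair_iff {a b : R} (ha : a ∈ nonZeroDivisors R) :
    IsDSequence ![a, b] ↔ ∀ r, b * b * r ∈ Ideal.span {a} → b * r ∈ Ideal.span {a} := by
  have h0 : (![a, b] '' {j | j < 0}) = ∅ := by simp
  have h1 : (![a, b] '' {j | j < 1}) = {a} := by
    ext; simp [eq_comm]
  constructor
  · intro h r hr
    have := h 1 1 le_rfl
    rw [h1] at this
    simp only [Matrix.cons_val_one, Matrix.cons_val_fin_one] at this
    rw [mul_comm, ← Ideal.mem_colon_span_singleton', ← this, Ideal.mem_colon_span_singleton']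
    rwa [mul_comm]
  · intro h i k hik
    ext r
    rw [Ideal.mem_colon_span_singleton', Ideal.mem_colon_span_singleton']
    refine ⟨fun hr => ?_, fun hr => ?_⟩
    · fin_cases i
      · simp only [Fin.zero_eta, h0, Ideal.span_empty, Ideal.mem_bot] at hr ⊢
        rw [mul_left_comm] at hr
        exact (mul_left_mem_nonZeroDivisors_eq_zero_iff ha).1 hr
      · obtain rfl : k = 1 := by lia
        simp only [Fin.mk_one, h1] at hr ⊢
        simp only [Matrix.cons_val_one, Matrix.cons_val_fin_one] at hr ⊢
        rw [mul_comm] at hr ⊢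
        exact h r hr
    · rw [mul_left_comm]
      exact Ideal.mul_mem_left _ _ hr

lemma Ideal.exists_eq_add_of_mem_span_pair_pow_succ {a b : R} {N : ℕ} {r : R}
    (hr : r ∈ Ideal.span {a, b} ^ (N + 1)) :
    ∃ u ∈ Ideal.span {a, b} ^ N, ∃ v ∈ Ideal.span {a, b} ^ N, r = a * u + b * v := by
  rw [pow_succ', Ideal.span_insert a {b}, Ideal.sup_mul, Submodule.mem_sup] at hr
  obtain ⟨s, hs, t, ht, rfl⟩ := hr
  obtain ⟨u, hu, rfl⟩ := Ideal.mem_span_singleton_mul.1 hs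
  obtain ⟨v, hv, rfl⟩ := Ideal.mem_span_singleton_mul.1 ht
  rw [← Ideal.span_insert a {b}] at hu hv
  exact ⟨u, hu, v, hv, rfl⟩

lemma Ideal.exists_eq_pow_mul_add_of_mem_span_pair_pow_succ {a b : R} {N : ℕ} {r : R}
    (hr : r ∈ Ideal.span {a, b} ^ (N + 1)) :
    ∃ u, ∃ v ∈ Ideal.span {a, b} ^ N, r = a ^ (N + 1) * u + b * v := by
  induction N generalizing r with
  | zero =>
    obtain ⟨u, -, v, hv, rfl⟩ := Ideal.exists_eq_add_of_mem_span_pair_pow_succ hr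
    exact ⟨u, v, hv, by ring⟩
  | succ N ih =>
    obtain ⟨u, hu, v, hv, rfl⟩ := Ideal.exists_eq_add_of_mem_span_pair_pow_succ hr
    obtain ⟨u', v', hv', rfl⟩ := ih hu
    refine ⟨u', a * v' + v, add_mem ?_ hv, by ring⟩
    rw [pow_succ']
    exact Ideal.mul_mem_mul (Ideal.subset_span (by simp)) hv'

lemma Ideal.exists_eq_add_of_mem_span_pair_pow_add {a b : R} {n N : ℕ} {r : R}
    (hr : r ∈ Ideal.span {a, b} ^ (n + N)) :
    ∃ u, ∃ v ∈ Ideal.span {a, b} ^ N, r = a ^ N * u + b ^ n * v := by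
  induction n generalizing r with
  | zero => exact ⟨0, r, by simpa using hr, by simp⟩
  | succ n ih =>
    rw [Nat.add_right_comm] at hr
    obtain ⟨u, v, hv, rfl⟩ := Ideal.exists_eq_pow_mul_add_of_mem_span_pair_pow_succ hr
    obtain ⟨u', v', hv', rfl⟩ := ih hv
    exact ⟨a ^ (n + 1) * u + b * u', v', hv', by ring⟩

lemma mem_span_pow_of_mem_pow {a b : R} (ha : a ∈ nonZeroDivisors R)
    (h : ∀ r, b * b * r ∈ Ideal.span {a} → b * r ∈ Ideal.span {a}) (N k : ℕ) (r : R)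
    (hr : r ∈ Ideal.span {a, b} ^ N) (hbr : b ^ k * r ∈ Ideal.span {a ^ N}) :
    r ∈ Ideal.span {a ^ N} := by
  have hb : ∀ m r, b ^ (m + 1) * r ∈ Ideal.span {a} → b * r ∈ Ideal.span {a} := by
    intro m
    induction m with
    | zero => intro r hr; simpa using hr
    | succ m ih =>
      intro r hr
      refine h r ?_
      have := ih (b * r) (by convert! hr using 1; ring)
      rwa [← mul_assoc] at this
  induction N generalizing r with
  | zero => simp
  | succ N ih =>
    have hr' := hr
    rw [Set.pair_comm] at hr'
    obtain ⟨c, q, hq, rfl⟩ := Ideal.exists_eq_pow_mul_add_of_mem_span_pair_pow_succ hr'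
    rw [Set.pair_comm] at hq
    obtain ⟨y, hy⟩ := Ideal.mem_span_singleton.1 hbr
    obtain ⟨s, hs⟩ := Ideal.mem_span_singleton.1 (hb (k + N) c (Ideal.mem_span_singleton.2
      ⟨a ^ N * y - b ^ k * q, by linear_combination hy⟩))
    have e : b ^ (N + 1) * c + a * q = a * (b ^ N * s + q) := by
      linear_combination b ^ N * hs
    rw [e] at hy ⊢
    have h1 := ih (b ^ N * s + q) (add_mem (Ideal.mul_mem_right _ _
      (Ideal.pow_mem_pow (Ideal.subset_span (by simp)) N)) hq) (Ideal.mem_span_singleton.2 ⟨y,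
        (mul_cancel_left_mem_nonZeroDivisors ha).1 (by linear_combination hy)⟩)
    obtain ⟨w, hw⟩ := Ideal.mem_span_singleton.1 h1
    exact Ideal.mem_span_singleton.2 ⟨w, by rw [hw]; ring⟩

lemma mul_mem_span_of_mem_pow {a b : R} (ha : a ∈ nonZeroDivisors R) (N k : ℕ)
    (h : ∀ r ∈ Ideal.span {a, b} ^ (N + 1), b ^ (k + 1) * r ∈ Ideal.span {a ^ (N + 1)} →
      r ∈ Ideal.span {a ^ (N + 1)})
    (r : R) (hr : b * b * r ∈ Ideal.span {a}) : b * r ∈ Ideal.span {a} := by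
  obtain ⟨u, hu⟩ := Ideal.mem_span_singleton.1 hr
  obtain ⟨w, hw⟩ := Ideal.mem_span_singleton.1 (h (a ^ N * b * r) (Ideal.mul_mem_right _ _ (by
    rw [pow_succ]
    exact Ideal.mul_mem_mul (Ideal.pow_mem_pow (Ideal.subset_span (by simp)) N)
      (Ideal.subset_span (by simp))))
    (Ideal.mem_span_singleton.2 ⟨b ^ k * u, by linear_combination b ^ k * a ^ N * hu⟩))
  exact Ideal.mem_span_singleton.2 ⟨w, (mul_cancel_left_mem_nonZeroDivisors (pow_mem ha N)).1
    (by linear_combination hw)⟩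

section

variable {M : Type*} [AddCommGroup M] [Module R M]

/-- If `g` is an endomorphism with `ker g² = ker g`, there is an exact sequence
`0 → ker g → M / g M → M / g² M → M / g M → 0`. -/
lemma Module.length_quotient_range_comp_self_add_length_ker (g : M →ₗ[R] M)
    (hg : ∀ m, g (g m) = 0 → g m = 0) :
    Module.length R (M ⧸ LinearMap.range (g ∘ₗ g)) + Module.length R (LinearMap.ker g) =
      Module.length R (M ⧸ LinearMap.range g) + Module.length R (M ⧸ LinearMap.range g) := by
  let φ : M ⧸ LinearMap.range g →ₗ[R] M ⧸ LinearMap.range (g ∘ₗ g) :=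
    Submodule.mapQ _ _ g (by rintro _ ⟨m, rfl⟩; exact ⟨m, rfl⟩)
  let ψ : M ⧸ LinearMap.range (g ∘ₗ g) →ₗ[R] M ⧸ LinearMap.range g :=
    Submodule.factor (LinearMap.range_comp_le_range g g)
  let κ : LinearMap.ker g →ₗ[R] M ⧸ LinearMap.range g :=
    (LinearMap.range g).mkQ ∘ₗ (LinearMap.ker g).subtype
  have hκ : Function.Injective κ := by
    rw [injective_iff_map_eq_zero]
    intro m hm
    obtain ⟨n, hn⟩ := (Submodule.Quotient.mk_eq_zero _).1 hm
    have hn' : g n = m := hn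
    have hm0 : g m = 0 := m.2
    rw [← hn'] at hm0
    exact Subtype.ext (hn'.symm.trans (hg n hm0))
  have hφκ : Function.Exact κ φ.rangeRestrict := by
    intro x
    obtain ⟨m, rfl⟩ := Submodule.mkQ_surjective _ x
    have : φ.rangeRestrict ((LinearMap.range g).mkQ m) = 0 ↔ g m ∈ LinearMap.range (g ∘ₗ g) := by
      rw [Subtype.ext_iff]
      exact Submodule.Quotient.mk_eq_zero _
    rw [this]
    constructor
    · rintro ⟨n, hn⟩
      refine ⟨⟨m - g n, by simpa [sub_eq_zero] using hn.symm⟩, ?_⟩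
      change (LinearMap.range g).mkQ (m - g n) = _
      rw [map_sub, sub_eq_self]
      exact (Submodule.Quotient.mk_eq_zero _).2 ⟨n, rfl⟩
    · rintro ⟨n, hn⟩
      obtain ⟨y, hy⟩ := (Submodule.Quotient.eq _).1 hn
      have hn0 : g n = 0 := n.2
      refine ⟨-y, ?_⟩
      have hy' : g y = n - m := hy
      simp [hy', hn0]
  have hψφ : Function.Exact (LinearMap.range φ).subtype ψ := by
    intro x
    obtain ⟨m, rfl⟩ := Submodule.mkQ_surjective _ x
    have : ψ ((LinearMap.range (g ∘ₗ g)).mkQ m) = 0 ↔ m ∈ LinearMap.range g :=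
      Submodule.Quotient.mk_eq_zero _
    rw [this]
    simp only [Submodule.coe_subtype, Subtype.range_coe_subtype, SetLike.setOfPred_mem_eq,
      SetLike.mem_coe]
    constructor
    · rintro ⟨n, rfl⟩
      exact ⟨(LinearMap.range g).mkQ n, rfl⟩
    · rintro ⟨n, hn⟩
      obtain ⟨n, rfl⟩ := Submodule.mkQ_surjective _ n
      obtain ⟨y, hy⟩ := (Submodule.Quotient.eq _).1 hn
      have hy' : g (g y) = g n - m := hy
      exact ⟨n - g y, by simp [hy']⟩
  rw [Module.length_eq_add_of_exact _ _ (Submodule.subtype_injective _)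
    (Submodule.factor_surjective _) hψφ, add_right_comm,
    add_comm (Module.length R (LinearMap.range φ)),
    ← Module.length_eq_add_of_exact _ _ hκ φ.surjective_rangeRestrict hφκ]

/-- Multiplication by `x` induces `0 → R / J → R / I → R / (I + (x)) → 0`. -/
lemma Module.length_quotient_eq_add_of_colon (I J : Ideal R) (x : R) (h : ∀ y, x * y ∈ I ↔ y ∈ J) :
    Module.length R (R ⧸ I) =
      Module.length R (R ⧸ J) + Module.length R (R ⧸ (Ideal.span {x} ⊔ I)) := by
  refine Module.length_eq_add_of_exact (Submodule.mapQ J I (LinearMap.mulLeft R x)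
    fun y hy => (h y).2 hy) (Submodule.factor le_sup_right) ?_
    (Submodule.factor_surjective _) ?_
  · rw [injective_iff_map_eq_zero]
    intro y hy
    obtain ⟨y, rfl⟩ := Submodule.mkQ_surjective _ y
    exact (Submodule.Quotient.mk_eq_zero _).2 ((h y).1 ((Submodule.Quotient.mk_eq_zero _).1 hy))
  · intro y
    obtain ⟨y, rfl⟩ := Submodule.mkQ_surjective _ y
    refine (Submodule.Quotient.mk_eq_zero _).trans ?_
    constructor
    · intro hy
      obtain ⟨s, hs, t, ht, rfl⟩ := Submodule.mem_sup.1 hy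
      obtain ⟨u, rfl⟩ := Ideal.mem_span_singleton.1 hs
      exact ⟨J.mkQ u, (Submodule.Quotient.eq _).2 (by simpa using ht)⟩
    · rintro ⟨u, hu⟩
      obtain ⟨u, rfl⟩ := Submodule.mkQ_surjective _ u
      have h1 : x * u - y ∈ I := (Submodule.Quotient.eq _).1 hu
      have h2 : y = x * u - (x * u - y) := by ring
      rw [h2]
      exact sub_mem (Ideal.mem_sup_left (Ideal.mul_mem_right _ _ (Ideal.mem_span_singleton_self x)))
        (Ideal.mem_sup_right h1)

/-- The quotient `I / K` of ideals `K ≤ I`, as a module. -/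
abbrev Ideal.Subquotient (I K : Ideal R) : Type _ :=
  ↥I ⧸ Submodule.comap (Submodule.subtype I) K

lemma Module.length_quotient_eq_add_of_le (I K : Ideal R) (b : R) (hK : K ≤ I) :
    Module.length R (R ⧸ (K ⊔ Ideal.span {b} * I)) =
      Module.length R (I.Subquotient K ⧸ LinearMap.range (LinearMap.lsmul R (I.Subquotient K) b)) +
        Module.length R (R ⧸ I) := by
  have hle : K ⊔ Ideal.span {b} * I ≤ I := sup_le hK Ideal.mul_le_right
  let q : I →ₗ[R] R ⧸ (K ⊔ Ideal.span {b} * I) := Submodule.mkQ _ ∘ₗ Submodule.subtype I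
  let q' : I.Subquotient K →ₗ[R] R ⧸ (K ⊔ Ideal.span {b} * I) :=
    (Submodule.comap (Submodule.subtype I) K).liftQ q fun y hy =>
      (Submodule.Quotient.mk_eq_zero _).2 (Ideal.mem_sup_left hy)
  let f : (I.Subquotient K ⧸ LinearMap.range (LinearMap.lsmul R (I.Subquotient K) b)) →ₗ[R]
      R ⧸ (K ⊔ Ideal.span {b} * I) :=
    Submodule.liftQ _ q' (by
      rintro _ ⟨y, rfl⟩
      obtain ⟨y, rfl⟩ := Submodule.mkQ_surjective _ y
      exact (Submodule.Quotient.mk_eq_zero _).2 (Ideal.mem_sup_right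
        (Ideal.mul_mem_mul (Ideal.mem_span_singleton_self b) y.2)))
  refine Module.length_eq_add_of_exact f (Submodule.factor hle) ?_
    (Submodule.factor_surjective _) ?_
  · rw [injective_iff_map_eq_zero]
    intro y hy
    obtain ⟨y, rfl⟩ := Submodule.mkQ_surjective _ y
    obtain ⟨y, rfl⟩ := Submodule.mkQ_surjective _ y
    obtain ⟨s, hs, t, ht, hst⟩ := Submodule.mem_sup.1 ((Submodule.Quotient.mk_eq_zero _).1 hy)
    obtain ⟨u, hu, rfl⟩ := Ideal.mem_span_singleton_mul.1 ht
    refine (Submodule.Quotient.mk_eq_zero _).2 ⟨Submodule.Quotient.mk ⟨u, hu⟩, ?_⟩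
    refine (Submodule.Quotient.eq _).2 ?_
    change b * u - y ∈ K
    have h1 : (s + b * u : R) = y := hst
    rw [← h1, sub_add_cancel_right]
    exact neg_mem hs
  · intro y
    obtain ⟨y, rfl⟩ := Submodule.mkQ_surjective _ y
    refine (Submodule.Quotient.mk_eq_zero _).trans ?_
    constructor
    · exact fun hy => ⟨Submodule.Quotient.mk (Submodule.Quotient.mk ⟨y, hy⟩), rfl⟩
    · rintro ⟨u, hu⟩
      obtain ⟨u, rfl⟩ := Submodule.mkQ_surjective _ u
      obtain ⟨u, rfl⟩ := Submodule.mkQ_surjective _ u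
      have h1 : (u : R) - y ∈ K ⊔ Ideal.span {b} * I := (Submodule.Quotient.eq _).1 hu
      have h2 : y = u - (u - y) := by ring
      rw [h2]
      exact sub_mem u.2 (hle h1)

end

lemma moduleLength_eq_natCast_iff {M : Type*} [AddCommGroup M] [Module R M] {l : ℕ} :
    moduleLength R M = (l : WithBot ℕ∞) ↔ Module.length R M = l := by
  rw [moduleLength, ← Module.coe_length]
  exact WithBot.coe_inj

lemma HasHilbertCoeffs.exists_length {Q : Ideal R} {e : ℕ → ℤ} (he : HasHilbertCoeffs Q 2 e) :
    ∃ N : ℕ, ∀ m ≥ N, ∃ l : ℕ, Module.length R (R ⧸ Q ^ m) = l ∧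
      2 * (l : ℤ) = e 0 * (m * (m + 1)) - 2 * (e 1 * m) + 2 * e 2 := by
  obtain ⟨N, hN⟩ := he
  refine ⟨N + 1, fun m hm => ?_⟩
  obtain ⟨n, rfl⟩ : ∃ n, m = n + 1 := ⟨m - 1, by lia⟩
  obtain ⟨l, hl, hle⟩ := hN n (by lia)
  refine ⟨l, moduleLength_eq_natCast_iff.1 hl, ?_⟩
  have h2 : ((n + 2).choose 2 : ℤ) * 2 = (n + 2) * (n + 1) := by
    have := Nat.add_one_mul_choose_eq (n + 1) 1
    rw [Nat.choose_one_right] at this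
    exact_mod_cast this.symm
  rw [hle]
  simp only [Finset.sum_range_succ, Finset.sum_range_zero, Nat.sub_zero, Nat.add_sub_cancel,
    Nat.sub_self, Nat.choose_zero_right, show n + 2 - 1 = n + 1 from rfl,
    show 2 - 1 = 1 from rfl, Nat.choose_one_right]
  push_cast
  linear_combination e 0 * h2

lemma exists_length_ker_lsmul {M : Type*} [AddCommGroup M] [Module R M] [IsNoetherian R M] (b : R)
    (α β : ℤ) (n₀ : ℕ) (hG : ∀ n ≥ n₀, ∃ G : ℕ,
      Module.length R (M ⧸ LinearMap.range (LinearMap.lsmul R M (b ^ n))) = G ∧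
      (G : ℤ) = α * n - β) :
    ∃ k t : ℕ, Module.length R (LinearMap.ker (LinearMap.lsmul R M (b ^ (k + 1)))) = t ∧
      (t : ℤ) = -β := by
  obtain ⟨n₁, hn₁⟩ := monotone_stabilizes_iff_noetherian.2 (inferInstance : IsNoetherian R M)
    ⟨fun n => LinearMap.ker (LinearMap.lsmul R M (b ^ n)), monotone_nat_of_le_succ fun n m hm => by
      simp only [LinearMap.mem_ker, LinearMap.lsmul_apply] at hm ⊢
      rw [pow_succ', mul_smul, hm, smul_zero]⟩
  let k := n₁ + n₀
  let g := LinearMap.lsmul R M (b ^ (k + 1))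
  have hgg : g ∘ₗ g = LinearMap.lsmul R M (b ^ (2 * (k + 1))) := by
    ext m
    simp [g, smul_smul, ← pow_add, two_mul]
  have hker : ∀ m, g (g m) = 0 → g m = 0 := by
    intro m hm
    have h1 : m ∈ LinearMap.ker (LinearMap.lsmul R M (b ^ (2 * (k + 1)))) := by
      rw [← hgg]
      exact hm
    have e1 := hn₁ (k + 1) (by lia)
    have e2 := hn₁ (2 * (k + 1)) (by lia)
    exact (e1.symm.trans e2).ge h1
  obtain ⟨G₁, hG₁, hG₁'⟩ := hG (k + 1) (by lia)
  obtain ⟨G₂, hG₂, hG₂'⟩ := hG (2 * (k + 1)) (by lia)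
  have h := Module.length_quotient_range_comp_self_add_length_ker g hker
  rw [hgg, hG₁, hG₂] at h
  refine ⟨k, ?_⟩
  change ∃ t : ℕ, Module.length R (LinearMap.ker g) = t ∧ _
  generalize Module.length R (LinearMap.ker g) = t at h ⊢
  induction t with
  | top => exact absurd h (by simp [← Nat.cast_add])
  | coe t =>
    refine ⟨t, rfl, ?_⟩
    have h3 : (G₂ + t : ℤ) = G₁ + G₁ := by exact_mod_cast h
    push_cast at hG₁' hG₂'
    linarith

lemma length_quotient_span_pair_pow_add {a b : R} {n N : ℕ}
    (h : ∀ y, a ^ N * y ∈ Ideal.span {a, b} ^ (n + N) → y ∈ Ideal.span {a, b} ^ n) :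
    Module.length R (R ⧸ Ideal.span {a, b} ^ (n + N)) =
      Module.length R (R ⧸ Ideal.span {a, b} ^ n) +
        (Module.length R ((Ideal.span {a, b} ^ N).Subquotient (Ideal.span {a ^ N}) ⧸
          LinearMap.range (LinearMap.lsmul R
            ((Ideal.span {a, b} ^ N).Subquotient (Ideal.span {a ^ N})) (b ^ n))) +
        Module.length R (R ⧸ Ideal.span {a, b} ^ N)) := by
  have haQ : a ∈ Ideal.span {a, b} := Ideal.subset_span (by simp)
  have hbQ : b ∈ Ideal.span {a, b} := Ideal.subset_span (by simp)
  have haN : Ideal.span {a ^ N} ≤ Ideal.span {a, b} ^ N := by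
    rw [Ideal.span_singleton_le_iff_mem]
    exact Ideal.pow_mem_pow haQ _
  rw [← Module.length_quotient_eq_add_of_le _ _ _ haN,
    Module.length_quotient_eq_add_of_colon (Ideal.span {a, b} ^ (n + N)) (Ideal.span {a, b} ^ n)
      (a ^ N) fun y => ⟨h y, fun hy => by
        rw [add_comm, pow_add]
        exact Ideal.mul_mem_mul (Ideal.pow_mem_pow haQ _) hy⟩]
  have h2 : Ideal.span {a ^ N} ⊔ Ideal.span {a, b} ^ (n + N) =
      Ideal.span {a ^ N} ⊔ Ideal.span {b ^ n} * Ideal.span {a, b} ^ N := by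
    apply le_antisymm
    · refine sup_le le_sup_left fun r hr => ?_
      obtain ⟨u, v, hv, rfl⟩ := Ideal.exists_eq_add_of_mem_span_pair_pow_add hr
      exact add_mem (Ideal.mem_sup_left (Ideal.mul_mem_right _ _
        (Ideal.mem_span_singleton_self _))) (Ideal.mem_sup_right
        (Ideal.mul_mem_mul (Ideal.mem_span_singleton_self _) hv))
    · refine sup_le le_sup_left (le_sup_of_le_right ?_)
      rw [pow_add]
      refine Ideal.mul_mono_left ?_
      rw [Ideal.span_singleton_le_iff_mem]
      exact Ideal.pow_mem_pow hbQ _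
  rw [h2]

lemma exists_length_ker_eq_neg [IsNoetherianRing R] {a b : R} (ha : a ∈ nonZeroDivisors R)
    (hsup : IsSuperficial (Ideal.span {a, b}) a) {e : ℕ → ℤ}
    (he : HasHilbertCoeffs (Ideal.span {a, b}) 2 e) :
    ∃ N k t : ℕ,
      Module.length R (LinearMap.ker (LinearMap.lsmul R
        ((Ideal.span {a, b} ^ (N + 1)).Subquotient (Ideal.span {a ^ (N + 1)})) (b ^ (k + 1)))) = t ∧
      (t : ℤ) = - e 2 := by
  obtain ⟨N, hN⟩ := he.exists_length
  obtain ⟨c, hc⟩ := hsup.exists_forall_mem_pow ha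
  refine ⟨N, exists_length_ker_lsmul b (e 0 * (N + 1)) (e 2) (N + c) fun n hn => ?_⟩
  have h1 := length_quotient_span_pair_pow_add (hc n (by lia) (N + 1))
  obtain ⟨l₁, hl₁, hl₁'⟩ := hN (n + (N + 1)) (by lia)
  obtain ⟨l₂, hl₂, hl₂'⟩ := hN n (by lia)
  obtain ⟨l₃, hl₃, hl₃'⟩ := hN (N + 1) (by lia)
  rw [hl₁, hl₂, hl₃] at h1
  generalize Module.length R ((Ideal.span {a, b} ^ (N + 1)).Subquotient (Ideal.span {a ^ (N + 1)}) ⧸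
    LinearMap.range (LinearMap.lsmul R
      ((Ideal.span {a, b} ^ (N + 1)).Subquotient (Ideal.span {a ^ (N + 1)})) (b ^ n))) = G at h1 ⊢
  induction G with
  | top => simp at h1
  | coe G =>
    refine ⟨G, rfl, ?_⟩
    have h3 : (l₁ : ℤ) = l₂ + (G + l₃) := by exact_mod_cast h1
    push_cast at hl₁' hl₂' hl₃'
    have h4 : 2 * (G : ℤ) = 2 * (e 0 * (N + 1) * n - e 2) := by
      linear_combination hl₁' - hl₂' - hl₃' - 2 * h3
    lia

lemma length_ker_le_of_linearMap {H : Type*} [AddCommGroup H] [Module R H] (I K : Ideal R) (b : R)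
    (T : Ideal R) (hT : ∀ r, r ∈ T ↔ r ∈ I ∧ b * r ∈ K) (f : T →ₗ[R] H)
    (hf : ∀ t, f t = 0 → (t : R) ∈ K) :
    Module.length R (LinearMap.ker (LinearMap.lsmul R (I.Subquotient K) b)) ≤
      Module.length R H := by
  let π : T →ₗ[R] LinearMap.ker (LinearMap.lsmul R (I.Subquotient K) b) :=
    LinearMap.codRestrict _ ((Submodule.mkQ _) ∘ₗ Submodule.inclusion fun r hr => ((hT r).1 hr).1)
      fun t => (Submodule.Quotient.mk_eq_zero _).2 ((hT t).1 t.2).2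
  have hπ : Function.Surjective π := by
    rintro ⟨x, hx⟩
    obtain ⟨x, rfl⟩ := Submodule.mkQ_surjective _ x
    have hbx : b * (x : R) ∈ K :=
      (Submodule.Quotient.mk_eq_zero (Submodule.comap (Submodule.subtype I) K) (x := b • x)).1 hx
    exact ⟨⟨x, (hT x).2 ⟨x.2, hbx⟩⟩, rfl⟩
  have hker : LinearMap.ker f ≤ LinearMap.ker π := fun t ht =>
    Subtype.ext ((Submodule.Quotient.mk_eq_zero _).2 (hf t ht))
  calc _ ≤ Module.length R (T ⧸ LinearMap.ker f) :=
        Module.length_le_of_surjective ((LinearMap.ker f).liftQ π hker) fun x => by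
          obtain ⟨t, rfl⟩ := hπ x
          exact ⟨Submodule.Quotient.mk t, rfl⟩
    _ = Module.length R (LinearMap.range f) := f.quotKerEquivRange.length_eq
    _ ≤ _ := Module.length_le_of_injective _ (Submodule.subtype_injective _)

lemma length_ker_lsmul_subquotient_eq_zero_iff (I K : Ideal R) (b : R) :
    Module.length R (LinearMap.ker (LinearMap.lsmul R (I.Subquotient K) b)) = 0 ↔
      ∀ r ∈ I, b * r ∈ K → r ∈ K := by
  rw [Module.length_eq_zero_iff, Submodule.subsingleton_iff_eq_bot, LinearMap.ker_eq_bot']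
  have hmk (x : I) :
      Submodule.Quotient.mk (p := Submodule.comap (Submodule.subtype I) K) x = 0 ↔ (x : R) ∈ K :=
    Submodule.Quotient.mk_eq_zero _
  constructor
  · exact fun h r hr hbr => (hmk ⟨r, hr⟩).1 (h _ ((hmk (b • (⟨r, hr⟩ : I))).2 hbr))
  · intro h x hx
    obtain ⟨x, rfl⟩ := Submodule.mkQ_surjective _ x
    exact (hmk x).2 (h x x.2 ((hmk (b • x)).1 hx))

lemma isDSequence_pair_iff_length_ker_eq_zero {a b : R} (ha : a ∈ nonZeroDivisors R) (N k : ℕ) :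
    Module.length R (LinearMap.ker (LinearMap.lsmul R
      ((Ideal.span {a, b} ^ (N + 1)).Subquotient (Ideal.span {a ^ (N + 1)})) (b ^ (k + 1)))) = 0 ↔
      IsDSequence ![a, b] := by
  rw [isDSequence_pair_iff ha, length_ker_lsmul_subquotient_eq_zero_iff]
  exact ⟨mul_mem_span_of_mem_pow ha N k, fun h => mem_span_pow_of_mem_pow ha h _ _⟩

lemma length_ker_le_length_localCohomology_one {a b : R} {I : Ideal R} {z : R} {m : ℕ}
    (ha : a ∈ nonZeroDivisors R) (hz : z ∈ nonZeroDivisors R) (hzI : z ∈ I)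
    (hI : I ^ m ≤ Ideal.span {a, b}) (N k : ℕ) :
    Module.length R (LinearMap.ker (LinearMap.lsmul R
      ((Ideal.span {a, b} ^ N).Subquotient (Ideal.span {a ^ N})) (b ^ k))) ≤
      Module.length R ((localCohomology I 1).obj (ModuleCat.of R R)) := by
  let T : Ideal R := Ideal.span {a, b} ^ N ⊓
    Submodule.comap (LinearMap.mulLeft R (b ^ k)) (Ideal.span {a ^ N})
  obtain ⟨f, hf⟩ := exists_linearMap_localCohomology_one I T (m * (k + N)) (a ^ N) z
    (pow_mem ha _) hz hzI fun t ht j hj => by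
      have hj' : j ∈ Ideal.span {a, b} ^ (k + N) := by
        rw [pow_mul] at hj
        exact Ideal.pow_right_mono hI _ hj
      obtain ⟨u, v, -, rfl⟩ := Ideal.exists_eq_add_of_mem_span_pair_pow_add hj'
      have hbt : b ^ k * t ∈ Ideal.span {a ^ N} := ht.2
      have h : t * (a ^ N * u + b ^ k * v) = a ^ N * (t * u) + b ^ k * t * v := by ring
      rw [h]
      exact add_mem (Ideal.mul_mem_right _ _ (Ideal.mem_span_singleton_self _))
        (Ideal.mul_mem_right _ _ hbt)
  exact length_ker_le_of_linearMap _ _ _ T (fun r => Iff.rfl) f hf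

lemma exists_maximalIdeal_pow_le_of_moduleLength [IsLocalRing R] {Q : Ideal R}
    (hQ : ∃ l : ℕ, moduleLength R (R ⧸ Q) = (l : WithBot ℕ∞)) :
    ∃ m : ℕ, maximalIdeal R ^ m ≤ Q := by
  obtain ⟨l, hl⟩ := hQ
  have h : IsFiniteLength R (R ⧸ Q) := by
    rw [← Module.length_ne_top_iff, moduleLength_eq_natCast_iff.1 hl]
    simp
  have : IsArtinian R (R ⧸ Q) := (isFiniteLength_iff_isNoetherian_isArtinian.1 h).2
  have : IsArtinianRing (R ⧸ Q) := isArtinian_of_tower R this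
  exact IsLocalRing.exists_maximalIdeal_pow_le_of_isArtinianRing_quotient Q

end

/-- **Goto–Ozeki (2011), Theorem 3.2**.  Let `(R,m)` be a Noetherian local ring of dimension
`2` with positive depth, and `Q = (a₁,a₂)` a parameter ideal with `a₁` superficial with
respect to `Q`.  Then `-λ(H¹_m(R)) ≤ e₂(Q) ≤ 0`, and `e₂(Q) = 0` iff `a₁, a₂` is a
d-sequence. -/
theorem e2_bounds_dim_two
    {R : Type u} [CommRing R] [IsNoetherianRing R] [IsLocalRing R]
    (hdim : ringKrullDim R = 2)
    (hdepth : ∃ x ∈ maximalIdeal R, x ∈ nonZeroDivisors R)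
    (a₁ a₂ : R) (Q : Ideal R) (hQgen : Q = Ideal.span {a₁, a₂})
    (hQm : Q ≤ maximalIdeal R)
    (hQfin : ∃ l : ℕ, moduleLength R (R ⧸ Q) = (l : WithBot ℕ∞))
    (hsup : IsSuperficial Q a₁)
    (e : ℕ → ℤ) (he : HasHilbertCoeffs Q 2 e) :
    e 2 ≤ 0 ∧
      (∀ h1 : ℕ, localCohomologyLength R R 1 = (h1 : WithBot ℕ∞) → -(h1 : ℤ) ≤ e 2) ∧
      (e 2 = 0 ↔ IsDSequence ![a₁, a₂]) := by
  subst hQgen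
  obtain ⟨m, hm⟩ := exists_maximalIdeal_pow_le_of_moduleLength hQfin
  obtain ⟨z, hzm, hz⟩ := hdepth
  have ha : a₁ ∈ nonZeroDivisors R :=
    hsup.mem_nonZeroDivisors (fun h => (maximalIdeal.isMaximal R).ne_top (top_le_iff.1 (h ▸ hQm)))
      (hm (Ideal.pow_mem_pow hzm m)) (pow_mem hz m)
  obtain ⟨N, k, t, ht, hte⟩ := exists_length_ker_eq_neg ha hsup he
  refine ⟨by lia, fun h1 hh1 => ?_, ?_⟩
  · have h := length_ker_le_length_localCohomology_one ha hz hzm hm (N + 1) (k + 1)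
    rw [ht, moduleLength_eq_natCast_iff.1 hh1] at h
    have : t ≤ h1 := by exact_mod_cast h
    lia
  · rw [← isDSequence_pair_iff_length_ker_eq_zero ha N k, ht, Nat.cast_eq_zero]
    lia
end
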